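/- arXiv:1004.1484 — 4 statements merged into one kernel-verified Lean document; each statement's English description precedes it below -/
import Mathlib

section
/- Let (F,G) be a Weierstrass data of an improper affine front on ℂ whose induced metric dτ² = 2(|F′(z)|² + |G′(z)|²)|dz|² is complete on ℂ. If the Lagrangian Gauss map ν = F′/G′ is constant, then F′ and G′ are both constant, i.e. F and G are polynomials of degree at most 1; consequently the corresponding improper affine front is an elliptic paraboloid (its Weierstrass data is (cz, z) up to an affine change of the coordinate z). -/
open MeasureTheory Set
open scoped ENNReal Classical

noncomputable section

/-- A path `γ : [0,1) → ℂ` is divergent if it eventually leaves every compact set. -/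
def DivergentPath (γ : ℝ → ℂ) : Prop :=
  ∀ K : Set ℂ, IsCompact K → ∃ t₀ ∈ Ico (0:ℝ) 1, ∀ t ∈ Ico t₀ 1, γ t ∉ K

/-- Length of `γ : [0,1) → ℂ` for the conformal metric `lam(z)²|dz|²`. -/
def PathLength (lam : ℂ → ℝ) (γ : ℝ → ℂ) : ℝ≥0∞ :=
  ∫⁻ t in Ico (0:ℝ) 1, ENNReal.ofReal (lam (γ t) * ‖derivWithin γ (Ico (0:ℝ) 1) t‖)

/-- The conformal metric `lam(z)²|dz|²` on `Ω` is complete: every (C¹) divergent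
path in `Ω` has infinite length. -/
def ConformalComplete (Ω : Set ℂ) (lam : ℂ → ℝ) : Prop :=
  ∀ γ : ℝ → ℂ, ContDiffOn ℝ 1 γ (Ico (0:ℝ) 1) → MapsTo γ (Ico (0:ℝ) 1) Ω →
    DivergentPath γ → PathLength lam γ = ⊤

/-- The Lagrangian Gauss map `ν = F′/G′ : Ω → ℂ ∪ {∞}` of the Weierstrass data `(F, G)`. -/
def LagrangianGaussMap (F G : ℂ → ℂ) (z : ℂ) : OnePoint ℂ :=
  if deriv G z = 0 then OnePoint.infty else ((deriv F z / deriv G z : ℂ) : OnePoint ℂ)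

open Filter Topology

section PathLifting

variable {E X : Type*} [TopologicalSpace E] {f : E → X} {c : ℝ → X}

/-- `γ` is a continuous lift of the path `c` through `f` over `s`, starting at `e` at time `0`. -/
structure IsLiftOn (f : E → X) (c : ℝ → X) (e : E) (s : Set ℝ) (γ : ℝ → E) : Prop where
  continuousOn : ContinuousOn γ s
  zero : γ 0 = e
  lifts : ∀ t ∈ s, f (γ t) = c t

theorem IsLiftOn.mono {e : E} {s t : Set ℝ} {γ : ℝ → E} (hγ : IsLiftOn f c e t γ) (h : s ⊆ t) :
    IsLiftOn f c e s γ :=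
  ⟨hγ.continuousOn.mono h, hγ.zero, fun x hx => hγ.lifts x (h hx)⟩

variable [TopologicalSpace X]

theorem IsLiftOn.eqOn [T2Space E] (hf : IsLocalHomeomorph f) {e : E} {T : ℝ} {γ₁ γ₂ : ℝ → E}
    (h₁ : IsLiftOn f c e (Icc 0 T) γ₁) (h₂ : IsLiftOn f c e (Icc 0 T) γ₂) :
    EqOn γ₁ γ₂ (Icc 0 T) := by
  intro t ht
  have h0 : (0 : ℝ) ∈ Icc 0 T := ⟨le_rfl, ht.1.trans ht.2⟩
  have : PreconnectedSpace (Icc (0 : ℝ) T) :=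
    isPreconnected_iff_preconnectedSpace.mp isPreconnected_Icc
  have := (T2Space.isSeparatedMap f).eq_of_comp_eq hf.isLocallyInjective
    (continuousOn_iff_continuous_domRestrict.mp h₁.continuousOn)
    (continuousOn_iff_continuous_domRestrict.mp h₂.continuousOn)
    (by ext x; simp [h₁.lifts x x.2, h₂.lifts x x.2])
    ⟨0, h0⟩ (by simp [h₁.zero, h₂.zero])
  exact congrFun this ⟨t, ht⟩

/-- A lift whose endpoint lies in the source of a local inverse can be prolonged as long as the
path stays in the target of that inverse. -/
theorem IsLiftOn.exists_extend (hc : Continuous c) {e : E} {s T : ℝ} {γ : ℝ → E} (hs : 0 ≤ s)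
    (hγ : IsLiftOn f c e (Icc 0 s) γ) (φ : OpenPartialHomeomorph E X) (hφ : f = φ)
    (hsource : γ s ∈ φ.source) (htarget : ∀ t ∈ Icc s T, c t ∈ φ.target) :
    ∃ γ', IsLiftOn f c e (Icc 0 T) γ' := by
  have hs' : φ.symm (c s) = γ s := by
    rw [← hγ.lifts s ⟨hs, le_rfl⟩, hφ, φ.left_inv hsource]
  refine ⟨fun t => if t ≤ s then γ t else φ.symm (c t), ?_, ?_, ?_⟩
  · refine ContinuousOn.if (fun t ht => ?_) (hγ.continuousOn.mono fun t ht => ?_) ?_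
    · have : t = s := mem_ofPred.mp (frontier_le_subset_eq continuous_id continuous_const ht.2)
      rw [this, hs']
    · exact ⟨ht.1.1, isClosed_Iic.closure_subset ht.2⟩
    · simp_rw [not_le]
      refine (φ.continuousOn_symm.comp hc.continuousOn htarget).mono fun t ht => ?_
      exact ⟨closure_lt_subset_le continuous_const continuous_id ht.2, ht.1.2⟩
  · simp [hs, hγ.zero]
  · intro t ht
    split_ifs with h
    · exact hγ.lifts t ⟨ht.1, h⟩
    · rw [hφ, φ.right_inv (htarget t ⟨(not_le.mp h).le, ht.2⟩)]

/-- A path lifts through a local homeomorphism as soon as every partial lift over a half-open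
interval accumulates somewhere at the missing endpoint. -/
theorem IsLocalHomeomorph.exists_isLiftOn [T2Space E] [T2Space X] (hf : IsLocalHomeomorph f)
    (hc : Continuous c) {e : E} (he : f e = c 0)
    (hcluster : ∀ T : ℝ, 0 < T → ∀ γ : ℝ → E, IsLiftOn f c e (Ico 0 T) γ →
      ∃ p, MapClusterPt p (𝓝[<] T) γ) (b : ℝ) :
    ∃ γ, IsLiftOn f c e (Icc 0 b) γ := by
  rcases lt_or_ge b 0 with hb | hb
  · exact ⟨fun _ => e, continuousOn_const, rfl, fun t ht => by
      simp only [mem_Icc] at ht; linarith⟩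
  set S : Set ℝ := {T | ∃ γ, IsLiftOn f c e (Icc 0 T) γ}
  have hdown : ∀ T ∈ S, ∀ t ≤ T, t ∈ S := fun T ⟨γ, hγ⟩ t ht =>
    ⟨γ, hγ.mono (Icc_subset_Icc_right ht)⟩
  have h0 : (0 : ℝ) ∈ S := ⟨fun _ => e, continuousOn_const, rfl, fun t ht => by
    rw [he, le_antisymm ht.2 ht.1]⟩
  have hclosed : IsClosed S := by
    refine isClosed_of_closure_subset fun T hT => ?_
    have hlt : ∀ t < T, t ∈ S := fun t ht => by
      obtain ⟨s, hts, hsS⟩ := mem_closure_iff.mp hT (Ioi t) isOpen_Ioi ht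
      exact hdown s hsS t (le_of_lt hts)
    rcases le_or_gt T 0 with hT0 | hT0
    · exact hdown 0 h0 T hT0
    have : Nonempty E := ⟨e⟩
    choose! Γ hΓ using hlt
    have hagree : ∀ s < T, EqOn (fun t => Γ t t) (Γ s) (Icc 0 s) := fun s hs t ht =>
      (hΓ t (ht.2.trans_lt hs)).eqOn hf ((hΓ s hs).mono (Icc_subset_Icc_right ht.2))
        ⟨ht.1, le_rfl⟩
    have hlift : ∀ s < T, 0 ≤ s → IsLiftOn f c e (Icc 0 s) (fun t => Γ t t) := fun s hs hs0 =>
      ⟨(hΓ s hs).continuousOn.congr (hagree s hs), (hΓ 0 hT0).zero,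
        fun t ht => (hΓ t (ht.2.trans_lt hs)).lifts t ⟨ht.1, le_rfl⟩⟩
    have hlift' : IsLiftOn f c e (Ico 0 T) (fun t => Γ t t) := by
      refine ⟨fun t ht => ?_, (hΓ 0 hT0).zero, fun t ht => (hΓ t ht.2).lifts t ⟨ht.1, le_rfl⟩⟩
      obtain ⟨s, hts, hsT⟩ := exists_between ht.2
      refine ((hlift s hsT (ht.1.trans hts.le)).continuousOn t ⟨ht.1, hts.le⟩).mono_of_mem_nhdsWithin
        ?_
      filter_upwards [self_mem_nhdsWithin, nhdsWithin_le_nhds (Iio_mem_nhds hts)] with x hx hx'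
      exact ⟨hx.1, le_of_lt hx'⟩
    obtain ⟨p, hp⟩ := hcluster T hT0 _ hlift'
    have hIco : ∀ᶠ t in 𝓝[<] T, t ∈ Ico 0 T := by
      filter_upwards [self_mem_nhdsWithin, nhdsWithin_le_nhds (Ioi_mem_nhds hT0)] with x hx hx'
      exact ⟨le_of_lt hx', hx⟩
    have hfp : f p = c T := by
      have h1 : MapClusterPt (f p) (𝓝[<] T) (f ∘ fun t => Γ t t) :=
        hp.continuousAt_comp hf.continuous.continuousAt
      have h2 : Tendsto (f ∘ fun t => Γ t t) (𝓝[<] T) (𝓝 (c T)) := by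
        refine ((hc.tendsto T).mono_left nhdsWithin_le_nhds).congr' ?_
        filter_upwards [hIco] with t ht
        exact (hlift'.lifts t ht).symm
      by_contra hne
      have := h1.clusterPt.neBot
      exact this.ne (((disjoint_nhds_nhds.mpr hne).mono_right h2).eq_bot)
    obtain ⟨φ, hpφ, hφ⟩ := hf p
    have htarget : ∀ᶠ t in 𝓝 T, c t ∈ φ.target := by
      refine hc.continuousAt.eventually (φ.open_target.mem_nhds ?_)
      rw [← hfp, hφ]; exact φ.map_source hpφ
    obtain ⟨l, hlT, hl⟩ : ∃ l < T, ∀ t ∈ Ioc l T, c t ∈ φ.target :=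
      (mem_nhdsLE_iff_exists_Ioc_subset).mp (nhdsWithin_le_nhds htarget)
    obtain ⟨s, hsφ, hsI, hsl⟩ := ((hp.frequently (φ.open_source.mem_nhds hpφ)).and_eventually
      (hIco.and (nhdsWithin_le_nhds (Ioi_mem_nhds hlT)))).exists
    exact (hlift s hsI.2 hsI.1).exists_extend hc hsI.1 φ hφ hsφ
      fun t ht => hl t ⟨lt_of_lt_of_le hsl ht.1, ht.2⟩
  refine (IsClosed.Icc_subset_of_forall_exists_gt (hclosed.inter isClosed_Icc) h0 ?_)
    ⟨hb, le_refl b⟩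
  rintro x ⟨⟨γ, hγ⟩, hx0, hxb⟩ y hy
  obtain ⟨φ, hxφ, hφ⟩ := hf (γ x)
  have htarget : ∀ᶠ t in 𝓝 x, c t ∈ φ.target := by
    refine hc.continuousAt.eventually (φ.open_target.mem_nhds ?_)
    rw [← hγ.lifts x ⟨hx0, le_rfl⟩, hφ]; exact φ.map_source hxφ
  obtain ⟨u, hxu, hu⟩ : ∃ u > x, ∀ t ∈ Ico x u, c t ∈ φ.target :=
    (mem_nhdsGE_iff_exists_Ico_subset).mp (nhdsWithin_le_nhds htarget)
  obtain ⟨z, hxz, hz⟩ := exists_between (lt_min hxu hy)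
  exact ⟨z, hγ.exists_extend hc hx0 φ hφ hxφ fun t ht =>
    hu t ⟨ht.1, ht.2.trans_lt (hz.trans_le (min_le_left _ _))⟩, hxz, hz.le.trans (min_le_right _ _)⟩

/-- A local homeomorphism into a real vector space through which all segments issuing from one
point lift is injective. -/
theorem IsLocalHomeomorph.injective_of_exists_isLiftOn [T2Space E] [PreconnectedSpace E]
    {V : Type*} [AddCommGroup V] [Module ℝ V] [TopologicalSpace V] [IsTopologicalAddGroup V]
    [ContinuousSMul ℝ V] {f : E → V} (hf : IsLocalHomeomorph f) (e : E)
    (hlift : ∀ v : V, ∃ γ, IsLiftOn f (fun t => f e + t • v) e (Icc 0 1) γ) :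
    Function.Injective f := by
  choose Γ hΓ using hlift
  let g : unitInterval × V → E := fun x => Γ (x.2 - f e) x.1
  have hg : Continuous g :=
    hf.continuous_lift (T2Space.isSeparatedMap f)
      ⟨fun x : unitInterval × V => f e + (x.1 : ℝ) • (x.2 - f e), by fun_prop⟩
      (by ext x; exact (hΓ _).lifts _ x.1.2)
      (by simpa [g, (hΓ _).zero] using continuous_const)
      (fun w => (hΓ (w - f e)).continuousOn.comp_continuous continuous_subtype_val
        fun t => t.2)
  have hsec : ∀ w, f (g (1, w)) = w := fun w => by
    simpa [g] using (hΓ (w - f e)).lifts 1 ⟨zero_le_one, le_rfl⟩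
  have hconst : IsLiftOn f (fun t => f e + t • (f e - f e)) e (Icc 0 1) fun _ => e :=
    ⟨continuousOn_const, rfl, by simp⟩
  have hbase : g (1, f e) = e := (hΓ (f e - f e)).eqOn hf hconst ⟨zero_le_one, le_rfl⟩
  have hinv : (fun z => g (1, f z)) = id :=
    (T2Space.isSeparatedMap f).eq_of_comp_eq hf.isLocallyInjective
      (hg.comp (continuous_const.prodMk hf.continuous)) continuous_id
      (by ext z; simp [hsec]) e hbase
  exact Function.LeftInverse.injective (g := fun w => g (1, w)) (congrFun hinv)

end PathLifting

section Entire

theorem isLocalHomeomorph_of_deriv_ne_zero {h : ℂ → ℂ} (hh : Differentiable ℂ h)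
    (hd : ∀ z, deriv h z ≠ 0) : IsLocalHomeomorph h := fun z =>
  have hs := ((hh.analyticAt z).hasStrictDerivAt.hasStrictFDerivAt_equiv (hd z))
  ⟨hs.toOpenPartialHomeomorph h, hs.mem_toOpenPartialHomeomorph_source, rfl⟩

/-- An injective entire function is affine. -/
theorem exists_affine_of_injective {h : ℂ → ℂ} (hh : Differentiable ℂ h)
    (hd : ∀ z, deriv h z ≠ 0) (hinj : Function.Injective h) :
    ∃ a b : ℂ, ∀ z, h z = a * z + b := by
  have hslope : ∀ z, z * dslope h 0 z = h z - h 0 := fun z => by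
    simpa using sub_smul_dslope h 0 z
  have hdsd : Differentiable ℂ (dslope h 0) := by
    rw [← differentiableOn_univ, Complex.differentiableOn_dslope univ_mem]
    exact hh.differentiableOn
  have hds0 : ∀ z, dslope h 0 z ≠ 0 := fun z hz => by
    rcases eq_or_ne z 0 with rfl | hz0
    · exact hd 0 (by simpa using hz)
    · refine hz0 (hinj (sub_eq_zero.mp ?_))
      rw [← hslope, hz, mul_zero]
  set φ : ℂ → ℂ := fun z => (dslope h 0 z)⁻¹ with hφ
  have hφd : Differentiable ℂ φ := hdsd.inv hds0
  obtain ⟨ε, hε, hball⟩ : ∃ ε > 0, Metric.ball (h 0) ε ⊆ h '' Metric.ball 0 1 :=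
    Metric.isOpen_iff.mp ((isLocalHomeomorph_of_deriv_ne_zero hh hd).isOpenMap _
      Metric.isOpen_ball) _ ⟨0, by simp, rfl⟩
  have hfar : ∀ z, 1 ≤ ‖z‖ → ε ≤ ‖h z - h 0‖ := fun z hz => by
    by_contra! hlt
    obtain ⟨y, hy, hyz⟩ := hball (show h z ∈ Metric.ball (h 0) ε by simpa [dist_eq_norm] using hlt)
    rw [hinj hyz] at hy
    exact absurd (mem_ball_zero_iff.mp hy) hz.not_gt
  have hφle : ∀ z, 1 ≤ ‖z‖ → ‖φ z‖ ≤ ‖z‖ / ε := fun z hz => by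
    have hz0 : z ≠ 0 := norm_pos_iff.mp (by linarith)
    have : φ z = z / (h z - h 0) := by
      rw [← hslope, hφ]; field_simp [hds0 z]
    rw [this, norm_div]
    gcongr
    exact hfar z hz
  have hψd : Differentiable ℂ (dslope φ 0) := by
    rw [← differentiableOn_univ, Complex.differentiableOn_dslope univ_mem]
    exact hφd.differentiableOn
  have hφslope : ∀ z, z * dslope φ 0 z = φ z - φ 0 := fun z => by
    simpa using sub_smul_dslope φ 0 z
  obtain ⟨C, hC⟩ := (isCompact_closedBall (0 : ℂ) 1).exists_bound_of_continuousOn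
    hψd.continuous.continuousOn
  have hψb : Bornology.IsBounded (range (dslope φ 0)) := by
    refine isBounded_iff_forall_norm_le.mpr ⟨max C (1 / ε + ‖φ 0‖), ?_⟩
    rintro _ ⟨z, rfl⟩
    rcases le_total ‖z‖ 1 with hz | hz
    · exact (hC z (by simpa using hz)).trans (le_max_left _ _)
    · refine le_trans ?_ (le_max_right _ _)
      have hz0 : 0 < ‖z‖ := by linarith
      refine le_of_mul_le_mul_left ?_ hz0
      rw [← norm_mul, hφslope]
      calc ‖φ z - φ 0‖ ≤ ‖φ z‖ + ‖φ 0‖ := norm_sub_le _ _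
        _ ≤ ‖z‖ / ε + ‖z‖ * ‖φ 0‖ := by
            gcongr
            · exact hφle z hz
            · exact le_mul_of_one_le_left (norm_nonneg _) hz
        _ = ‖z‖ * (1 / ε + ‖φ 0‖) := by ring
  obtain ⟨b, hb⟩ := hψd.exists_const_forall_eq_of_bounded hψb
  have hφb : ∀ z, φ z = φ 0 + z * b := fun z => by rw [← hb z, hφslope]; ring
  have hb0 : b = 0 := by
    by_contra hb0
    refine inv_ne_zero (hds0 (-φ 0 / b)) ?_
    change φ (-φ 0 / b) = 0
    rw [hφb]; field_simp; ring
  refine ⟨dslope h 0 0, h 0, fun z => ?_⟩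
  have : dslope h 0 z = dslope h 0 0 := inv_injective (by
    change φ z = φ 0
    simpa [hb0] using hφb z)
  rw [← this, mul_comm, hslope]; ring

/-- A lift of a segment through `h` is of class `C¹` and has finite length for any metric
proportional to `|h'|² |dz|²`, so it does not diverge if that metric is complete. -/
theorem IsLiftOn.not_divergentPath {h : ℂ → ℂ} (hh : Differentiable ℂ h)
    (hd : ∀ z, deriv h z ≠ 0) {k : ℝ}
    (hcomp : ConformalComplete univ fun z => k * ‖deriv h z‖) {e w v : ℂ} {σ : ℝ → ℂ}
    (hσ : IsLiftOn h (fun t => w + t • v) e (Ico 0 1) σ) : ¬ DivergentPath σ := by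
  intro hdiv
  have hC1 : ContDiffOn ℝ 1 σ (Ico 0 1) := fun t ht => by
    obtain ⟨φ, htφ, hφ⟩ := isLocalHomeomorph_of_deriv_ne_zero hh hd (σ t)
    have hsymm : φ.symm (w + t • v) = σ t := by
      rw [← hσ.lifts t ht, hφ, φ.left_inv htφ]
    have hmem : w + t • v ∈ φ.target := by
      rw [← hσ.lifts t ht, hφ]; exact φ.map_source htφ
    have h1 : ContDiffAt ℝ 1 φ.symm (w + t • v) := by
      refine (φ.contDiffAt_symm_deriv (hd (σ t)) hmem ?_ ?_).restrict_scalars ℝ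
      · rw [hsymm, ← hφ]; exact (hh _).hasDerivAt
      · rw [← hφ]; exact hh.contDiff.contDiffAt
    have h2 : ContDiffAt ℝ 1 (fun s : ℝ => φ.symm (w + s • v)) t :=
      h1.comp t (f := fun s : ℝ => w + s • v) (by fun_prop)
    refine h2.contDiffWithinAt.congr_of_eventuallyEq ?_ hsymm.symm
    filter_upwards [hσ.continuousOn t ht (φ.open_source.mem_nhds htφ), self_mem_nhdsWithin]
      with s hs hsI
    rw [← hσ.lifts s hsI, hφ, φ.left_inv hs]
  have hspeed : ∀ t ∈ Ico (0 : ℝ) 1,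
      k * ‖deriv h (σ t)‖ * ‖derivWithin σ (Ico (0 : ℝ) 1) t‖ = k * ‖v‖ := fun t ht => by
    have h1 := (hh (σ t)).hasDerivAt.comp_hasDerivWithinAt t
      ((hC1.differentiableOn one_ne_zero) t ht).hasDerivWithinAt
    have h2 : HasDerivWithinAt (h ∘ σ) v (Ico 0 1) t := by
      have : HasDerivAt (fun s : ℝ => w + s • v) v t := by
        simpa using ((hasDerivAt_id t).smul_const v).const_add w
      exact this.hasDerivWithinAt.congr hσ.lifts (hσ.lifts t ht)
    rw [← ((uniqueDiffOn_Ico 0 1) t ht).eq_deriv _ h1 h2, norm_mul, mul_assoc]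
  have hlen := hcomp σ hC1 (mapsTo_univ _ _) hdiv
  refine absurd hlen (ne_of_lt ?_)
  unfold PathLength
  rw [setLIntegral_congr_fun measurableSet_Ico fun t ht => by rw [hspeed t ht]]
  simp

/-- If a metric proportional to `|h'|² |dz|²` is complete, all segments lift through `h`. -/
theorem exists_isLiftOn_segment {h : ℂ → ℂ} (hh : Differentiable ℂ h)
    (hd : ∀ z, deriv h z ≠ 0) {k : ℝ}
    (hcomp : ConformalComplete univ fun z => k * ‖deriv h z‖) (e v : ℂ) :
    ∃ γ, IsLiftOn h (fun t => h e + t • v) e (Icc 0 1) γ := by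
  refine (isLocalHomeomorph_of_deriv_ne_zero hh hd).exists_isLiftOn (by fun_prop) (by simp)
    (fun T hT γ hγ => ?_) 1
  have hmaps : MapsTo (fun t => T * t) (Ico 0 1) (Ico 0 T) := fun t ht =>
    ⟨mul_nonneg hT.le ht.1, by simpa using mul_lt_mul_of_pos_left ht.2 hT⟩
  have hσ : IsLiftOn h (fun t => h e + t • (T • v)) e (Ico 0 1) (fun t => γ (T * t)) :=
    ⟨hγ.continuousOn.comp (by fun_prop) hmaps, by simp [hγ.zero], fun t ht => by
      rw [hγ.lifts _ (hmaps ht), smul_smul, mul_comm]⟩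
  have hnd := hσ.not_divergentPath hh hd hcomp
  simp only [DivergentPath] at hnd
  push Not at hnd
  obtain ⟨K, hK, hret⟩ := hnd
  have hfreq : ∃ᶠ t in 𝓝[<] (1 : ℝ), γ (T * t) ∈ K := by
    rw [Filter.Frequently, (nhdsLT_basis (1 : ℝ)).eventually_iff]
    rintro ⟨l, hl, hlK⟩
    obtain ⟨m, hm, hm1⟩ := exists_between (max_lt hl one_pos)
    obtain ⟨t, ht, htK⟩ := hret m ⟨((le_max_right _ _).trans hm.le), hm1⟩
    exact hlK ⟨((le_max_left _ _).trans_lt hm).trans_le ht.1, ht.2⟩ htK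
  obtain ⟨p, -, hp⟩ := hK.exists_mapClusterPt_of_frequently hfreq
  refine ⟨p, MapClusterPt.of_comp (φ := fun t => T * t) ?_ hp⟩
  refine tendsto_nhdsWithin_iff.mpr ⟨?_, ?_⟩
  · have : Continuous fun t : ℝ => T * t := by fun_prop
    simpa using (this.tendsto 1).mono_left nhdsWithin_le_nhds
  · filter_upwards [self_mem_nhdsWithin] with t ht
    simpa using mul_lt_mul_of_pos_left ht hT

/-- A nowhere critical entire function `h` for which a metric proportional to `|h'|² |dz|²` is
complete is affine. -/
theorem exists_affine_of_conformalComplete {h : ℂ → ℂ} (hh : Differentiable ℂ h)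
    (hd : ∀ z, deriv h z ≠ 0) {k : ℝ}
    (hcomp : ConformalComplete univ fun z => k * ‖deriv h z‖) :
    ∃ a b : ℂ, ∀ z, h z = a * z + b :=
  exists_affine_of_injective hh hd <|
    (isLocalHomeomorph_of_deriv_ne_zero hh hd).injective_of_exists_isLiftOn 0
      fun v => exists_isLiftOn_segment hh hd hcomp 0 v

theorem exists_affine_of_deriv_eq {f : ℂ → ℂ} (hf : Differentiable ℂ f) {a : ℂ}
    (ha : ∀ z, deriv f z = a) : ∃ c d : ℂ, ∀ z, f z = c * z + d := by
  refine ⟨a, f 0, fun z => ?_⟩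
  have hd : ∀ z, HasDerivAt (fun z => f z - a * z) 0 z := fun z => by
    convert! (hf z).hasDerivAt.sub ((hasDerivAt_id z).const_mul a) using 1
    simp [ha]
  have := is_const_of_deriv_eq_zero (fun z => (hd z).differentiableAt) (fun z => (hd z).deriv) z 0
  simp only [mul_zero, sub_zero] at this
  linear_combination this

end Entire

/-- **Proposition 3.1** (case `Σ = ℂ`): a weakly complete improper affine front on `ℂ`
with constant Lagrangian Gauss map has constant `F′` and `G′`, i.e. `F` and `G` are
polynomials of degree at most one (so the front is an elliptic paraboloid, with
Weierstrass data `(cz, z)` up to an affine change of the coordinate). -/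
theorem constant_gauss_map_implies_elliptic_paraboloid
    (F G : ℂ → ℂ) (hF : Differentiable ℂ F) (hG : Differentiable ℂ G)
    (hreg : ∀ z : ℂ, deriv F z ≠ 0 ∨ deriv G z ≠ 0)
    (hcomp : ConformalComplete Set.univ
      (fun z => Real.sqrt (2 * (‖deriv F z‖ ^ 2 + ‖deriv G z‖ ^ 2))))
    (hconst : ∀ z w : ℂ, LagrangianGaussMap F G z = LagrangianGaussMap F G w) :
    (∃ a b : ℂ, ∀ z : ℂ, F z = a * z + b) ∧ (∃ c d : ℂ, ∀ z : ℂ, G z = c * z + d) := by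
  rcases eq_or_ne (deriv G 0) 0 with hG0 | hG0
  · have hG' : ∀ z, deriv G z = 0 := fun z => by
      by_contra hz
      simpa [LagrangianGaussMap, hG0, hz] using hconst z 0
    refine ⟨exists_affine_of_conformalComplete hF (k := √2)
      (fun z => (hreg z).resolve_right (not_not.mpr (hG' z))) ?_,
      exists_affine_of_deriv_eq hG hG'⟩
    convert! hcomp using 2 with z
    simp [hG']
  · have hG' : ∀ z, deriv G z ≠ 0 := fun z hz => by
      simpa [LagrangianGaussMap, hG0, hz] using hconst z 0
    obtain ⟨c, hc⟩ : ∃ c, ∀ z, deriv F z = c * deriv G z :=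
      ⟨deriv F 0 / deriv G 0, fun z => by
        have := hconst z 0
        simp only [LagrangianGaussMap, hG', if_false, OnePoint.coe_eq_coe] at this
        rw [← this, div_mul_cancel₀ _ (hG' z)]⟩
    obtain ⟨a, b, hab⟩ := exists_affine_of_conformalComplete hG (k := √(2 * (‖c‖ ^ 2 + 1))) hG' (by
      convert! hcomp using 2 with z
      rw [hc, norm_mul, show 2 * ((‖c‖ * ‖deriv G z‖) ^ 2 + ‖deriv G z‖ ^ 2) =
        2 * (‖c‖ ^ 2 + 1) * ‖deriv G z‖ ^ 2 by ring, Real.sqrt_mul (by positivity) (‖deriv G z‖ ^ 2),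
        Real.sqrt_sq (norm_nonneg _)])
    have hGa : ∀ z, deriv G z = a := fun z => by
      rw [funext hab]; simp
    exact ⟨exists_affine_of_deriv_eq hF fun z => by rw [hc, hGa], a, b, hab⟩

end
end

section
/- Let ℰ : ℂ → SL(2,ℂ) be a holomorphic Legendrian curve with canonical form coefficients ω̂, θ̂ having no common zeros, and suppose the metric ds²₁,₁ = (|ω̂(z)|² + |θ̂(z)|²)|dz|² is complete on ℂ. If the ratio ρ = θ̂/ω̂ is constant, then ω̂ and θ̂ are both constant; consequently the corresponding flat front f = ℰℰ* in hyperbolic three-space is a horosphere or a hyperbolic cylinder. -/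
open MeasureTheory Set
open scoped ENNReal Classical Matrix

noncomputable section

/-- The ratio `ρ = θ̂/ω̂ : Ω → ℂ ∪ {∞}` of the canonical forms of a holomorphic
Legendrian curve. -/
def canonicalRatio (om th : ℂ → ℂ) (z : ℂ) : OnePoint ℂ :=
  if om z = 0 then OnePoint.infty else ((th z / om z : ℂ) : OnePoint ℂ)

/-- `E : Ω → SL(2,ℂ)` is a holomorphic Legendrian curve with canonical form
coefficients `ω̂ = om` and `θ̂ = th`: `E` is holomorphic with `det E = 1` and
`E⁻¹E′ = [[0, θ̂],[ω̂, 0]]`, with `ω̂`, `θ̂` holomorphic on `Ω`. -/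
structure IsLegendrian (Ω : Set ℂ) (E : ℂ → Matrix (Fin 2) (Fin 2) ℂ)
    (om th : ℂ → ℂ) : Prop where
  holo : ∀ i j, DifferentiableOn ℂ (fun z => E z i j) Ω
  det_one : ∀ z ∈ Ω, (E z).det = 1
  om_holo : DifferentiableOn ℂ om Ω
  th_holo : DifferentiableOn ℂ th Ω
  legendrian : ∀ z ∈ Ω, ∀ i j,
    deriv (fun w => E w i j) z = (E z * Matrix.of ![![0, th z], ![om z, 0]]) i j

section

open Filter Topology Asymptotics Bornology Complex

/-- An entire function of polynomial growth is a polynomial. -/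
theorem Complex.exists_polynomial_of_isBigO_pow (n : ℕ) {f : ℂ → ℂ} (hf : Differentiable ℂ f)
    (hO : f =O[cobounded ℂ] fun z => z ^ n) : ∃ p : Polynomial ℂ, ∀ z, f z = p.eval z := by
  induction n generalizing f with
  | zero =>
    obtain ⟨C, hC⟩ := hO.bound
    obtain ⟨R, -, hR⟩ := hasBasis_cobounded_norm.eventually_iff.1 hC
    obtain ⟨c, hc⟩ := hf.exists_const_forall_eq_of_bounded (by
      refine (((isCompact_closedBall (0 : ℂ) R).image hf.continuous).isBounded.union
        (Metric.isBounded_closedBall (x := 0) (r := C))).subset ?_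
      rintro _ ⟨z, rfl⟩
      rcases le_total ‖z‖ R with h | h
      · exact Or.inl ⟨z, by simpa using h, rfl⟩
      · exact Or.inr (by simpa using hR h))
    exact ⟨Polynomial.C c, by simpa using hc⟩
  | succ n ih =>
    have hg : Differentiable ℂ (dslope f 0) := by
      rw [← differentiableOn_univ, differentiableOn_dslope univ_mem]
      exact hf.differentiableOn
    have hne : ∀ᶠ z : ℂ in cobounded ℂ, z ≠ 0 := eventually_ne_cobounded 0
    obtain ⟨p, hp⟩ := ih hg (by
      have h1 : (fun z => f z - f 0) =O[cobounded ℂ] fun z => z ^ (n + 1) := by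
        refine hO.sub (IsBigO.trans (g := fun _ => (1 : ℂ)) (isBigO_const_const _ one_ne_zero _) ?_)
        refine IsBigO.of_bound 1 ?_
        filter_upwards [tendsto_norm_cobounded_atTop.eventually_ge_atTop 1] with z hz
        simpa using one_le_pow₀ hz
      refine ((isBigO_refl (fun z : ℂ => z⁻¹) _).mul h1).congr' ?_ ?_
      · filter_upwards [hne] with z hz
        simp [dslope_of_ne _ hz, slope_def_field, div_eq_inv_mul]
      · filter_upwards [hne] with z hz
        field_simp
        ring)
    refine ⟨Polynomial.C (f 0) + Polynomial.X * p, fun z => ?_⟩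
    have := sub_smul_dslope f 0 z
    simp [← hp]
    simp at this
    rw [this]; ring

/-- An entire function with `|f(z)| → ∞` as `|z| → ∞` is a polynomial. -/
theorem Complex.exists_polynomial_of_tendsto_cobounded {f : ℂ → ℂ} (hf : Differentiable ℂ f)
    (hlim : Tendsto f (cobounded ℂ) (cobounded ℂ)) :
    ∃ p : Polynomial ℂ, ∀ z, f z = p.eval z := by
  have hinv : Tendsto (fun u : ℂ => u⁻¹) (𝓝[≠] 0) (cobounded ℂ) := tendsto_inv₀_nhdsNE_zero
  set φ : ℂ → ℂ := Function.update (fun u => (f u⁻¹)⁻¹) 0 0 with hφ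
  have hφe : φ =ᶠ[𝓝[≠] 0] fun u => (f u⁻¹)⁻¹ := by
    filter_upwards [self_mem_nhdsWithin] with u hu
    simp [hφ, Function.update_of_ne hu]
  have hne : ∀ᶠ u : ℂ in 𝓝[≠] 0, f u⁻¹ ≠ 0 :=
    (hlim.comp hinv).eventually (eventually_ne_cobounded 0)
  have hcont : ContinuousAt φ 0 := by
    rw [hφ, continuousAt_update_same]
    exact tendsto_inv₀_cobounded.comp (hlim.comp hinv)
  have han : AnalyticAt ℂ φ 0 := by
    refine analyticAt_of_differentiable_on_punctured_nhds_of_continuousAt ?_ hcont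
    filter_upwards [hne, self_mem_nhdsWithin] with u hu hu0
    have : DifferentiableAt ℂ (fun u => (f u⁻¹)⁻¹) u :=
      ((hf _).comp u (differentiableAt_inv hu0)).inv hu
    refine this.congr_of_eventuallyEq ?_
    filter_upwards [isOpen_ne.mem_nhds hu0] with v hv
    simp [hφ, Function.update_of_ne hv]
  have hnz : ¬ ∀ᶠ u in 𝓝 (0 : ℂ), φ u = 0 := fun h => by
    obtain ⟨u, h1, h2, h3⟩ := ((h.filter_mono nhdsWithin_le_nhds).and (hφe.and hne)).exists
    rw [h1] at h2
    exact h3 (inv_eq_zero.1 h2.symm)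
  obtain ⟨n, g, hg, hg0, hgφ⟩ := han.exists_eventuallyEq_pow_smul_nonzero_iff.2 hnz
  refine exists_polynomial_of_isBigO_pow n hf ?_
  have hginv : (fun u => (g u)⁻¹) =O[𝓝[≠] 0] fun _ => (1 : ℂ) :=
    ((hg.continuousAt.inv₀ hg0).tendsto.isBigO_one ℂ).mono nhdsWithin_le_nhds
  have hf' : (fun u => f u⁻¹) =O[𝓝[≠] 0] fun u => (u⁻¹) ^ n := by
    refine ((isBigO_refl (fun u : ℂ => u⁻¹ ^ n) _).mul hginv).congr' ?_ (by simp)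
    filter_upwards [hφe, hgφ.filter_mono nhdsWithin_le_nhds] with u h1 h2
    rw [h1] at h2
    rw [← inv_inv (f u⁻¹), h2]
    simp [mul_comm]
  simpa [Function.comp_def] using hf'.comp_tendsto tendsto_inv₀_cobounded'

end

section

open Filter Topology

theorem isLocalHomeomorph_of_hasDerivAt {F h : ℂ → ℂ} (hF : ∀ z, HasDerivAt F (h z) z)
    (hh : Continuous h) (h0 : ∀ z, h z ≠ 0) : IsLocalHomeomorph F := by
  refine IsLocalHomeomorph.mk F fun z => ?_
  have hs : HasStrictDerivAt F (h z) z := hasStrictDerivAt_of_hasDerivAt_of_continuousAt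
    (Eventually.of_forall hF) hh.continuousAt
  exact ⟨_, (hs.hasStrictFDerivAt_equiv (h0 z)).mem_toOpenPartialHomeomorph_source,
    fun _ _ => rfl⟩

/-- A continuous lift of a real-differentiable path through a holomorphic function with nonvanishing
derivative is differentiable. -/
theorem hasDerivWithinAt_of_comp {F h : ℂ → ℂ} (hF : ∀ z, HasDerivAt F (h z) z)
    (hh : Continuous h) (h0 : ∀ z, h z ≠ 0) {γ σ : ℝ → ℂ} {s : Set ℝ} {t : ℝ} {σ' : ℂ}
    (hγ : ContinuousWithinAt γ s t) (hlift : ∀ u ∈ s, F (γ u) = σ u) (ht : t ∈ s)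
    (hσ : HasDerivWithinAt σ σ' s t) : HasDerivWithinAt γ (σ' / h (γ t)) s t := by
  have hs : HasStrictDerivAt F (h (γ t)) (γ t) := hasStrictDerivAt_of_hasDerivAt_of_continuousAt
    (Eventually.of_forall hF) hh.continuousAt
  have hG := (hs.to_localInverse (h0 _)).hasDerivAt
  rw [hlift t ht] at hG
  have hcomp := hG.scomp_hasDerivWithinAt (h := σ) t hσ
  have hleft := hγ.eventually (hs.eventually_left_inverse (h0 _))
  rw [smul_eq_mul, ← div_eq_mul_inv] at hcomp
  refine hcomp.congr_of_eventuallyEq ?_ ?_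
  · filter_upwards [hleft, self_mem_nhdsWithin] with u hu hus
    rw [Function.comp_apply, ← hlift u hus, hu]
  · rw [Function.comp_apply, ← hlift t ht]
    exact (hleft.self_of_nhdsWithin ht).symm

/-- A lift of a segment through a primitive of `h` has finite length, so it cannot diverge. -/
theorem not_divergentPath_of_lift {F h : ℂ → ℂ} {lam : ℂ → ℝ} {k : ℝ}
    (hF : ∀ z, HasDerivAt F (h z) z) (hh : Continuous h) (h0 : ∀ z, h z ≠ 0)
    (hlam : ∀ z, lam z = k * ‖h z‖) (hcomp : ConformalComplete univ lam) {γ : ℝ → ℂ} {c w : ℂ}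
    (hγ : ContinuousOn γ (Ico 0 1)) (hlift : ∀ t ∈ Ico (0 : ℝ) 1, F (γ t) = c + t * w) :
    ¬ DivergentPath γ := by
  intro hdiv
  have hd : ∀ t ∈ Ico (0 : ℝ) 1, HasDerivWithinAt γ (w / h (γ t)) (Ico 0 1) t := fun t ht =>
    hasDerivWithinAt_of_comp hF hh h0 (hγ t ht) hlift ht (by
      simpa using ((Complex.ofRealCLM.hasDerivAt (x := t)).mul_const w).const_add c
        |>.hasDerivWithinAt)
  have hu : UniqueDiffOn ℝ (Ico (0 : ℝ) 1) := uniqueDiffOn_Ico 0 1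
  have hderiv : ∀ t ∈ Ico (0 : ℝ) 1, derivWithin γ (Ico 0 1) t = w / h (γ t) :=
    fun t ht => (hd t ht).derivWithin (hu t ht)
  have hC1 : ContDiffOn ℝ 1 γ (Ico 0 1) := by
    rw [contDiffOn_one_iff_derivWithin hu]
    refine ⟨fun t ht => (hd t ht).differentiableWithinAt, ContinuousOn.congr ?_ hderiv⟩
    exact continuousOn_const.div (hh.comp_continuousOn hγ) fun t _ => h0 _
  have hlen := hcomp γ hC1 (mapsTo_univ _ _) hdiv
  have hconst : PathLength lam γ = ∫⁻ _ in Ico (0 : ℝ) 1, ENNReal.ofReal (k * ‖w‖) := by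
    refine setLIntegral_congr_fun measurableSet_Ico fun t ht => ?_
    have : ‖h (γ t)‖ ≠ 0 := norm_ne_zero_iff.2 (h0 _)
    simp only [hderiv t ht, hlam, norm_div]
    congr 1
    field_simp
  rw [hconst] at hlen
  simp at hlen

/-- A non-divergent lift of a half-open segment converges at the open end. -/
theorem exists_tendsto_of_lift {F : ℂ → ℂ} (hF : IsLocalHomeomorph F) {γ : ℝ → ℂ} {c w : ℂ}
    (hγ : ContinuousOn γ (Ico 0 1)) (hlift : ∀ t ∈ Ico (0 : ℝ) 1, F (γ t) = c + t * w)
    (hdiv : ¬ DivergentPath γ) : ∃ p, Tendsto γ (𝓝[<] 1) (𝓝 p) := by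
  simp only [DivergentPath] at hdiv
  push Not at hdiv
  obtain ⟨K, hK, hfreq⟩ := hdiv
  have hfreq' : ∃ᶠ t in 𝓝[<] (1 : ℝ), γ t ∈ K := by
    rw [(nhdsLT_basis (1 : ℝ)).frequently_iff]
    intro a ha
    obtain ⟨t, ht, htK⟩ := hfreq (max 0 ((a + 1) / 2))
      ⟨le_max_left _ _, max_lt one_pos (by linarith)⟩
    exact ⟨t, ⟨by linarith [le_max_right 0 ((a + 1) / 2), ht.1], ht.2⟩, htK⟩
  obtain ⟨p, -, hp⟩ := hK.exists_mapClusterPt_of_frequently hfreq'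
  have hσ : Continuous fun t : ℝ => c + t * w := by fun_prop
  have hIco : Ico (0 : ℝ) 1 ∈ 𝓝[<] 1 := Ico_mem_nhdsLT one_pos
  have hFp : F p = c + (1 : ℝ) * w := by
    have h1 : MapClusterPt (F p) (𝓝[<] (1 : ℝ)) (F ∘ γ) :=
      hp.continuousAt_comp hF.continuous.continuousAt
    have h2 : Tendsto (F ∘ γ) (𝓝[<] (1 : ℝ)) (𝓝 (c + (1 : ℝ) * w)) := by
      refine (hσ.continuousAt.mono_left nhdsWithin_le_nhds : Tendsto _ _ _).congr' ?_
      filter_upwards [hIco] with t ht using (hlift t ht).symm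
    exact eq_of_nhds_neBot (ClusterPt.mono h1 h2)
  obtain ⟨e, hpe, rfl⟩ := hF p
  have htgt : ∀ᶠ t : ℝ in 𝓝[<] 1, c + t * w ∈ e.target :=
    (hσ.continuousAt.mono_left nhdsWithin_le_nhds).eventually
      (e.open_target.mem_nhds (by simpa only [← hFp] using e.map_source hpe))
  obtain ⟨a, ha1, ha⟩ := (nhdsLT_basis (1 : ℝ)).mem_iff.1 (inter_mem htgt hIco)
  obtain ⟨t₁, ht₁e, ht₁⟩ := ((hp.frequently (e.open_source.mem_nhds hpe)).and_eventually
    (Ioo_mem_nhdsLT ha1)).exists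
  have hsub : ∀ t ∈ Ico t₁ 1, c + t * w ∈ e.target ∧ t ∈ Ico (0 : ℝ) 1 := fun t ht =>
    ha ⟨ht₁.1.trans_le ht.1, ht.2⟩
  have hEq : EqOn γ (fun t => e.symm (c + t * w)) (Ico t₁ 1) := by
    have ht₁' : t₁ ∈ Ico t₁ 1 := ⟨le_rfl, ht₁.2⟩
    refine (T2Space.isSeparatedMap e).eqOn_of_comp_eqOn hF.isLocallyInjective
      isPreconnected_Ico (hγ.mono fun t ht => (hsub t ht).2)
      (e.continuousOn_symm.comp hσ.continuousOn fun t ht => (hsub t ht).1) (fun t ht => ?_)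
      ht₁' ?_
    · simp [hlift t (hsub t ht).2, e.right_inv (hsub t ht).1]
    · rw [← hlift t₁ (hsub t₁ ht₁').2, e.left_inv ht₁e]
  refine ⟨p, Tendsto.congr' (f₁ := fun t : ℝ => e.symm (c + t * w)) ?_ ?_⟩
  · filter_upwards [Ico_mem_nhdsLT ht₁.2] with t ht using (hEq ht).symm
  · have h1 : Tendsto e.symm (𝓝 (c + (1 : ℝ) * w)) (𝓝 p) := by
      rw [← hFp]
      simpa [e.left_inv hpe] using (e.continuousAt_symm (e.map_source hpe)).tendsto
    exact h1.comp (hσ.continuousAt.mono_left nhdsWithin_le_nhds)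

/-- If lifts of half-open segments through a local homeomorphism converge at the open end, then
every segment lifts from every starting point. -/
theorem IsLocalHomeomorph.exists_segment_lift {F : ℂ → ℂ} (hF : IsLocalHomeomorph F)
    (hlim : ∀ (γ : ℝ → ℂ) (c w : ℂ), ContinuousOn γ (Ico 0 1) →
      (∀ t ∈ Ico (0 : ℝ) 1, F (γ t) = c + t * w) → ∃ p, Tendsto γ (𝓝[<] 1) (𝓝 p))
    (z₀ w : ℂ) : ∃ γ : ℝ → ℂ, ContinuousOn γ (Icc 0 1) ∧ γ 0 = z₀ ∧
      ∀ t ∈ Icc (0 : ℝ) 1, F (γ t) = F z₀ + t * w := by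
  set P : ℝ → Prop := fun s => ∃ γ : ℝ → ℂ, ContinuousOn γ (Icc 0 s) ∧ γ 0 = z₀ ∧
      ∀ t ∈ Icc (0 : ℝ) s, F (γ t) = F z₀ + t * w
  have hσ : Continuous fun t : ℝ => F z₀ + t * w := by fun_prop
  have hmono : ∀ r s, r ≤ s → P s → P r := fun r s hrs ⟨γ, h1, h2, h3⟩ =>
    ⟨γ, h1.mono (Icc_subset_Icc_right hrs), h2, fun t ht => h3 t ⟨ht.1, ht.2.trans hrs⟩⟩
  have hzero : P 0 := ⟨fun _ => z₀, continuousOn_const, rfl, fun t ht => by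
    simp [le_antisymm ht.2 ht.1]⟩
  have hopen : ∀ s, 0 ≤ s → P s → ∃ r > s, P r := by
    rintro s hs ⟨γ, h1, h2, h3⟩
    obtain ⟨e, he, rfl⟩ := hF (γ s)
    have hsm : s ∈ Icc 0 s := ⟨hs, le_rfl⟩
    have htgt : ∀ᶠ t : ℝ in 𝓝[>] s, e z₀ + t * w ∈ e.target :=
      (hσ.continuousAt.mono_left nhdsWithin_le_nhds).eventually
        (e.open_target.mem_nhds (by simpa only [← h3 s hsm] using e.map_source he))
    obtain ⟨b, hb, hbt⟩ := (nhdsGT_basis s).mem_iff.1 htgt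
    have hbt' : ∀ t ∈ Ico s b, e z₀ + t * w ∈ e.target := fun t ht => by
      rcases ht.1.eq_or_lt with rfl | h
      · rw [← h3 s hsm]; exact e.map_source he
      · exact hbt ⟨h, ht.2⟩
    have hsb : s ≤ (s + b) / 2 := by linarith
    refine ⟨(s + b) / 2, by linarith, fun t => if t ≤ s then γ t else e.symm (e z₀ + t * w),
      ?_, by simp [hs, h2], fun t ht => ?_⟩
    · rw [← Icc_union_Icc_eq_Icc hs hsb]
      refine ContinuousOn.union_of_isClosed (h1.congr fun t ht => if_pos ht.2)
        (ContinuousOn.congr (f := fun t : ℝ => e.symm (e z₀ + t * w)) ?_ fun t ht => ?_)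
        isClosed_Icc isClosed_Icc
      · exact e.continuousOn_symm.comp hσ.continuousOn
          fun t ht => hbt' t ⟨ht.1, by linarith [ht.2]⟩
      · rcases ht.1.eq_or_lt with rfl | h
        · simp [← h3 s hsm, e.left_inv he]
        · simp [h.not_ge]
    · rcases le_or_gt t s with h | h
      · simpa [h] using h3 t ⟨ht.1, h⟩
      · simp [h.not_ge, e.right_inv (hbt' t ⟨h.le, by linarith [ht.2]⟩)]
  have hclosed : ∀ s, 0 < s → (∀ r ∈ Ico 0 s, P r) → P s := by
    intro s hs h
    choose! g hg1 hg2 hg3 using h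
    set γ : ℝ → ℂ := fun t => g t t with hγ
    have hγg : ∀ r ∈ Ico 0 s, EqOn γ (g r) (Icc 0 r) := fun r hr t ht => by
      have hts : t ∈ Ico 0 s := ⟨ht.1, ht.2.trans_lt hr.2⟩
      have hsub : Icc 0 t ⊆ Icc 0 r := Icc_subset_Icc_right ht.2
      refine (T2Space.isSeparatedMap F).eqOn_of_comp_eqOn hF.isLocallyInjective
        isPreconnected_Icc (hg1 t hts) ((hg1 r hr).mono hsub)
        (fun u hu => (hg3 t hts u hu).trans (hg3 r hr u (hsub hu)).symm)
        (left_mem_Icc.2 ht.1) ?_ (right_mem_Icc.2 ht.1)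
      rw [hg2 t hts, hg2 r hr]
    have hlift : ∀ t ∈ Ico 0 s, F (γ t) = F z₀ + t * w := fun t ht =>
      hg3 t ht t (right_mem_Icc.2 ht.1)
    have hcont : ContinuousOn γ (Ico 0 s) := by
      intro t ht
      have hr : (t + s) / 2 ∈ Ico 0 s := ⟨by linarith [ht.1], by linarith [ht.2]⟩
      have h1 : ContinuousWithinAt γ (Icc 0 ((t + s) / 2)) t :=
        ((hg1 _ hr).congr (hγg _ hr)) t ⟨ht.1, by linarith [ht.2]⟩
      refine h1.mono_of_mem_nhdsWithin ?_
      filter_upwards [self_mem_nhdsWithin,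
        mem_nhdsWithin_of_mem_nhds (Iio_mem_nhds (show t < (t + s) / 2 by linarith [ht.2]))]
        with u hu hu' using ⟨hu.1, le_of_lt hu'⟩
    have hscale : MapsTo (fun t : ℝ => s * t) (Ico 0 1) (Ico 0 s) := fun t ht =>
      ⟨mul_nonneg hs.le ht.1, by nlinarith [ht.2]⟩
    obtain ⟨p, hp⟩ := hlim (fun t => γ (s * t)) (F z₀) (s * w)
      (hcont.comp (by fun_prop) hscale) fun t ht => by
        rw [hlift _ (hscale ht)]; push_cast; ring
    have hp' : Tendsto γ (𝓝[<] s) (𝓝 p) := by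
      have hdiv : Tendsto (fun t : ℝ => t / s) (𝓝[<] s) (𝓝[<] 1) := by
        refine tendsto_nhdsWithin_iff.2 ⟨?_, ?_⟩
        · have : Tendsto (fun t : ℝ => t / s) (𝓝 s) (𝓝 (s / s)) := tendsto_id.div_const s
          rw [div_self hs.ne'] at this
          exact this.mono_left nhdsWithin_le_nhds
        · filter_upwards [self_mem_nhdsWithin] with t ht using (div_lt_one hs).2 ht
      refine (hp.comp hdiv).congr fun t => ?_
      simp [mul_div_cancel₀ t hs.ne']
    have hIco : Ico 0 s ∈ 𝓝[<] s := Ico_mem_nhdsLT hs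
    refine ⟨Function.update γ s p, ?_, ?_, ?_⟩
    · rw [continuousOn_update_iff, Icc_sdiff_right]
      exact ⟨hcont, fun _ => hp'.mono_left (nhdsWithin_mono _ Ico_subset_Iio_self)⟩
    · rw [Function.update_of_ne hs.ne]
      exact hg2 0 ⟨le_rfl, hs⟩
    · intro t ht
      rcases ht.2.eq_or_lt with rfl | hts
      · rw [Function.update_self]
        refine tendsto_nhds_unique ((hF.continuous.tendsto p).comp hp') ?_
        refine (hσ.continuousAt.mono_left nhdsWithin_le_nhds : Tendsto _ _ _).congr' ?_
        filter_upwards [hIco] with u hu using (hlift u hu).symm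
      · rw [Function.update_of_ne hts.ne]
        exact hlift t ⟨ht.1, hts⟩
  set S : Set ℝ := {s | s ∈ Icc (0 : ℝ) 1 ∧ P s}
  have hSb : BddAbove S := ⟨1, fun s hs => hs.1.2⟩
  have h0S : (0 : ℝ) ∈ S := ⟨⟨le_rfl, zero_le_one⟩, hzero⟩
  have hT0 : 0 ≤ sSup S := le_csSup hSb h0S
  have hPT : P (sSup S) := by
    rcases hT0.eq_or_lt with h | h
    · rwa [← h]
    · refine hclosed _ h fun r hr => ?_
      obtain ⟨s, hs, hrs⟩ := exists_lt_of_lt_csSup ⟨0, h0S⟩ hr.2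
      exact hmono r s hrs.le hs.2
  obtain ⟨r, hr, hPr⟩ := hopen _ hT0 hPT
  refine hmono 1 r ?_ hPr
  by_contra! hr1
  exact hr.not_ge (le_csSup hSb ⟨⟨hT0.trans hr.le, hr1.le⟩, hPr⟩)

/-- A local homeomorphism of the plane through which all segments lift is a
homeomorphism. -/
theorem IsLocalHomeomorph.isHomeomorph_of_segment_lift {F : ℂ → ℂ} (hF : IsLocalHomeomorph F)
    (hlift : ∀ z₀ w : ℂ, ∃ γ : ℝ → ℂ, ContinuousOn γ (Icc 0 1) ∧ γ 0 = z₀ ∧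
      ∀ t ∈ Icc (0 : ℝ) 1, F (γ t) = F z₀ + t * w) : IsHomeomorph F := by
  choose γ hγ hγ0 hγF using hlift 0
  set g : unitInterval × ℂ → ℂ := fun x => γ (x.2 - F 0) x.1 with hg
  have hsep := T2Space.isSeparatedMap F
  have hgF : ∀ x, F (g x) = F 0 + (x.1 : ℝ) * (x.2 - F 0) := fun x => hγF _ _ x.1.2
  have hgc : Continuous g := by
    refine hF.continuous_lift hsep ⟨fun x => F 0 + ((x.1 : ℝ) : ℂ) * (x.2 - F 0), by fun_prop⟩
      (funext hgF) ?_ fun a => ?_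
    · simpa [hg, hγ0] using continuous_const
    · exact (hγ (a - F 0)).comp_continuous continuous_subtype_val fun t => t.2
  set G : ℂ → ℂ := fun z => g (1, z) with hG
  have hGc : Continuous G := hgc.comp (by fun_prop)
  have hFG : ∀ z, F (G z) = z := fun z => by simp [hG, hgF]
  have hG0 : G (F 0) = 0 := by
    have := hsep.const_of_comp hF.isLocallyInjective (g := fun t => g (t, F 0))
      (hgc.comp (by fun_prop)) (fun a b => by simp [hgF]) 1 0
    simpa [hG, hg, hγ0] using this
  have hGF : G ∘ F = id := hsep.eq_of_comp_eq hF.isLocallyInjective (hGc.comp hF.continuous)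
    continuous_id (funext fun z => by simp [hFG]) 0 (by simpa using hG0)
  exact (Homeomorph.mk ⟨F, G, congr_fun hGF, hFG⟩ hF.continuous hGc).isHomeomorph

/-- A complete conformal metric on `ℂ` of the form `k²|h|²|dz|²`, with `h` entire and nowhere
vanishing, has constant `h`. -/
theorem exists_eq_const_of_conformalComplete {h : ℂ → ℂ} {lam : ℂ → ℝ} {k : ℝ}
    (hh : Differentiable ℂ h) (h0 : ∀ z, h z ≠ 0) (hlam : ∀ z, lam z = k * ‖h z‖)
    (hcomp : ConformalComplete univ lam) : ∃ a, ∀ z, h z = a := by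
  obtain ⟨F, hF⟩ := hh.isExactOn_univ
  replace hF : ∀ z, HasDerivAt F (h z) z := fun z => hF z (mem_univ z)
  have hloc := isLocalHomeomorph_of_hasDerivAt hF hh.continuous h0
  have hhomeo : IsHomeomorph F := hloc.isHomeomorph_of_segment_lift
    (hloc.exists_segment_lift fun γ c w hγ hlift => exists_tendsto_of_lift hloc hγ hlift
      (not_divergentPath_of_lift hF hh.continuous h0 hlam hcomp hγ hlift))
  have hlim : Tendsto F (Bornology.cobounded ℂ) (Bornology.cobounded ℂ) := by
    rw [Metric.cobounded_eq_cocompact]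
    exact hhomeo.isClosedEmbedding.tendsto_cocompact
  obtain ⟨p, hp⟩ := Complex.exists_polynomial_of_tendsto_cobounded
    (fun z => (hF z).differentiableAt) hlim
  have hder : ∀ z, h z = p.derivative.eval z := fun z =>
    (hF z).unique (by simpa only [← funext hp] using p.hasDerivAt z)
  have hdeg : p.derivative.degree = 0 := by
    by_contra hne
    obtain ⟨z, hz⟩ := IsAlgClosed.exists_root _ hne
    exact h0 z ((hder z).trans hz)
  refine ⟨p.derivative.coeff 0, fun z => ?_⟩
  rw [hder, Polynomial.eq_C_of_degree_eq_zero hdeg]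
  simp

end

/-- **Proposition 4.4** (case `Σ = ℂ`): a weakly complete flat front given by a
holomorphic Legendrian curve `E : ℂ → SL(2,ℂ)` whose ratio of canonical forms
`ρ = θ̂/ω̂` is constant has constant `ω̂` and `θ̂`; consequently the flat front
`f = EE*` is a horosphere or a hyperbolic cylinder. -/
theorem constant_canonical_ratio_implies_constant_forms
    (E : ℂ → Matrix (Fin 2) (Fin 2) ℂ) (om th : ℂ → ℂ)
    (hLeg : IsLegendrian Set.univ E om th)
    (hreg : ∀ z : ℂ, om z ≠ 0 ∨ th z ≠ 0)
    (hcomp : ConformalComplete Set.univ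
      (fun z => Real.sqrt (‖om z‖ ^ 2 + ‖th z‖ ^ 2)))
    (hconst : ∀ z w : ℂ, canonicalRatio om th z = canonicalRatio om th w) :
    (∃ a : ℂ, ∀ z : ℂ, om z = a) ∧ (∃ b : ℂ, ∀ z : ℂ, th z = b) := by
  have hom : Differentiable ℂ om := differentiableOn_univ.1 hLeg.om_holo
  have hth : Differentiable ℂ th := differentiableOn_univ.1 hLeg.th_holo
  by_cases h0 : om 0 = 0
  · have hom0 : ∀ z, om z = 0 := fun z => by
      by_contra hz
      simpa [canonicalRatio, h0, hz] using hconst z 0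
    exact ⟨⟨0, hom0⟩, exists_eq_const_of_conformalComplete (k := 1) hth
      (fun z => (hreg z).resolve_left (not_not.2 (hom0 z))) (fun z => by simp [hom0]) hcomp⟩
  · have hom0 : ∀ z, om z ≠ 0 := fun z hz => by
      simpa [canonicalRatio, h0, hz] using hconst z 0
    have hratio : ∀ z, th z = th 0 / om 0 * om z := fun z => by
      have h1 := hconst z 0
      simp only [canonicalRatio, h0, hom0 z, if_false, OnePoint.coe_eq_coe] at h1
      rw [← h1, div_mul_cancel₀ _ (hom0 z)]
    obtain ⟨a, ha⟩ := exists_eq_const_of_conformalComplete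
      (k := Real.sqrt (1 + ‖th 0 / om 0‖ ^ 2)) hom hom0 (fun z => by
        rw [hratio z, norm_mul, ← Real.sqrt_sq (norm_nonneg (om z)),
          ← Real.sqrt_mul (by positivity), Real.sqrt_sq (norm_nonneg (om z))]
        ring_nf) hcomp
    exact ⟨⟨a, ha⟩, th 0 / om 0 * a, fun z => by rw [hratio, ha z]⟩

end
end

section
/- Let h : ℂ → ℂ be a nowhere-vanishing entire function such that the flat conformal metric |h(z)|²|dz|² is complete on ℂ. Then h is constant. -/
open MeasureTheory Set
open scoped ENNReal Classical

noncomputable section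

open Filter Topology Metric

section PathLifting

variable {E X : Type*} [TopologicalSpace E] {p : E → X}

/-- `γ` restricts to a continuous lift of `σ` through `p` on `[0, s]`, starting at `e₀`. -/
structure IsLiftUpTo (p : E → X) (σ : ℝ → X) (e₀ : E) (s : ℝ) (γ : ℝ → E) : Prop where
  continuousOn : ContinuousOn γ (Icc 0 s)
  map_zero : γ 0 = e₀
  lifts : ∀ t ∈ Icc 0 s, p (γ t) = σ t

theorem IsLiftUpTo.mono {σ : ℝ → X} {e₀ : E} {s t : ℝ} {γ : ℝ → E}
    (hγ : IsLiftUpTo p σ e₀ s γ) (hts : t ≤ s) : IsLiftUpTo p σ e₀ t γ :=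
  ⟨hγ.continuousOn.mono (Icc_subset_Icc_right hts), hγ.map_zero,
    fun u hu => hγ.lifts u (Icc_subset_Icc_right hts hu)⟩

theorem IsLiftUpTo.eqOn [TopologicalSpace X] [T2Space E] (hp : IsLocalHomeomorph p)
    {σ : ℝ → X} {e₀ : E} {s : ℝ} {γ γ' : ℝ → E} (hs : 0 ≤ s) (hγ : IsLiftUpTo p σ e₀ s γ)
    (hγ' : IsLiftUpTo p σ e₀ s γ') :
    EqOn γ γ' (Icc 0 s) :=
  (T2Space.isSeparatedMap p).eqOn_of_comp_eqOn hp.isLocallyInjective isPreconnected_Icc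
    hγ.continuousOn hγ'.continuousOn (fun t ht => (hγ.lifts t ht).trans (hγ'.lifts t ht).symm)
    (left_mem_Icc.2 hs) (hγ.map_zero.trans hγ'.map_zero.symm)

/-- A lift can be prolonged as long as the path stays in the target of a chart around its
endpoint. -/
theorem IsLiftUpTo.exists_extension [TopologicalSpace X] {σ : ℝ → X} (hσ : Continuous σ)
    {e₀ : E} {s s' : ℝ} {γ : ℝ → E} (hs : 0 ≤ s) (hγ : IsLiftUpTo p σ e₀ s γ)
    (e : OpenPartialHomeomorph E X)
    (he : ∀ x, e x = p x) (hsource : γ s ∈ e.source)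
    (htarget : ∀ t ∈ Icc s s', σ t ∈ e.target) :
    ∃ γ', IsLiftUpTo p σ e₀ s' γ' := by
  have hglue : e.symm (σ s) = γ s := by
    rw [← hγ.lifts s (right_mem_Icc.2 hs), ← he, e.left_inv hsource]
  refine ⟨fun t => if t ≤ s then γ t else e.symm (σ t), ?_, by simp [hs, hγ.map_zero], ?_⟩
  · refine ContinuousOn.if ?_ ?_ ?_
    · rintro t ⟨-, ht⟩
      have : t = s := by simpa using frontier_le_subset_eq continuous_id continuous_const ht
      rw [this, hglue]
    · refine hγ.continuousOn.mono fun t ht => ⟨ht.1.1, ?_⟩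
      exact (closure_le_eq continuous_id continuous_const).subset ht.2
    · refine e.continuousOn_symm.comp hσ.continuousOn fun t ht => htarget t ⟨?_, ht.1.2⟩
      have := ht.2
      simp only [not_le] at this
      simpa using closure_lt_subset_le continuous_const continuous_id this
  · intro t ht
    by_cases hts : t ≤ s
    · simpa [hts] using hγ.lifts t ⟨ht.1, hts⟩
    · simp only [hts, if_false]
      rw [← he, e.right_inv (htarget t ⟨(not_le.1 hts).le, ht.2⟩)]

/-- Path lifting for a local homeomorphism such that no lift escapes in finite time. -/
theorem IsLocalHomeomorph.exists_isLiftUpTo [TopologicalSpace X] [T2Space E] [T2Space X]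
    (hp : IsLocalHomeomorph p) {σ : ℝ → X} (hσ : Continuous σ) {e₀ : E} (h₀ : p e₀ = σ 0)
    (hcluster : ∀ T > 0, ∀ γ : ℝ → E, ContinuousOn γ (Ico 0 T) →
      (∀ t ∈ Ico 0 T, p (γ t) = σ t) → ∃ z, MapClusterPt z (𝓝[<] T) γ)
    (s : ℝ) : ∃ γ, IsLiftUpTo p σ e₀ s γ := by
  by_contra hs
  set S : Set ℝ := {t | 0 ≤ t ∧ ∃ γ, IsLiftUpTo p σ e₀ t γ}
  have hbdd : ∀ t ∈ S, t ≤ s := by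
    rintro t ⟨-, γ, hγ⟩
    by_contra! hlt
    exact hs ⟨γ, hγ.mono hlt.le⟩
  have hconst : IsLiftUpTo p σ e₀ 0 fun _ => e₀ :=
    ⟨continuousOn_const, rfl, fun t ht => by
      obtain rfl : t = 0 := le_antisymm ht.2 ht.1
      exact h₀⟩
  have hS0 : (0 : ℝ) ∈ S := ⟨le_rfl, _, hconst⟩
  have hBdd : BddAbove S := ⟨s, hbdd⟩
  set T := sSup S
  have hT0 : 0 ≤ T := le_csSup hBdd hS0
  have key : ∀ e : OpenPartialHomeomorph E X, (∀ x, e x = p x) → σ T ∈ e.target →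
      ∃ δ > 0, ∀ t γ, 0 ≤ t → T - δ < t → t ≤ T → IsLiftUpTo p σ e₀ t γ →
        γ t ∉ e.source := by
    intro e he hmem
    obtain ⟨δ, hδ, hball⟩ := Metric.mem_nhds_iff.1
      (hσ.continuousAt.preimage_mem_nhds (e.open_target.mem_nhds hmem))
    refine ⟨δ, hδ, fun t γ ht0 ht htT hγ hsource => ?_⟩
    obtain ⟨γ', hγ'⟩ := hγ.exists_extension (s' := T + δ / 2) hσ ht0 e he hsource fun u hu => by
      refine hball ?_
      rw [Metric.mem_ball, Real.dist_eq, abs_lt]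
      constructor <;> linarith [hu.1, hu.2]
    have : T + δ / 2 ≤ T := le_csSup hBdd ⟨by linarith, γ', hγ'⟩
    linarith
  have hTpos : 0 < T := by
    refine lt_of_le_of_ne hT0 fun h => ?_
    obtain ⟨e, hsource, rfl⟩ := hp e₀
    obtain ⟨δ, hδ, hno⟩ := key e (fun _ => rfl) (by rw [← h, ← h₀]; exact e.map_source hsource)
    exact hno 0 _ le_rfl (by linarith) hT0 hconst hsource
  have hex : ∀ t : ℝ, ∃ γ, t < T → IsLiftUpTo p σ e₀ t γ := by
    intro t
    by_cases ht : t < T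
    · obtain ⟨u, ⟨-, γ, hγ⟩, htu⟩ := exists_lt_of_lt_csSup ⟨0, hS0⟩ ht
      exact ⟨γ, fun _ => hγ.mono htu.le⟩
    · exact ⟨fun _ => e₀, fun h => absurd h ht⟩
  choose Γ hΓ using hex
  set γ : ℝ → E := fun t => Γ t t
  have hγ : ∀ t, 0 ≤ t → t < T → IsLiftUpTo p σ e₀ t γ := by
    intro t ht0 ht
    have heq : EqOn γ (Γ t) (Icc 0 t) := fun u hu =>
      (hΓ u (hu.2.trans_lt ht)).eqOn hp hu.1 ((hΓ t ht).mono hu.2) (right_mem_Icc.2 hu.1)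
    exact ⟨(hΓ t ht).continuousOn.congr heq,
      (heq (left_mem_Icc.2 ht0)).trans (hΓ t ht).map_zero,
      fun u hu => (congrArg p (heq hu)).trans ((hΓ t ht).lifts u hu)⟩
  have hlift : ∀ t ∈ Ico 0 T, p (γ t) = σ t := fun t ht =>
    (hγ t ht.1 ht.2).lifts t (right_mem_Icc.2 ht.1)
  have hcont : ContinuousOn γ (Ico 0 T) := by
    intro t ht
    obtain ⟨u, htu, huT⟩ := exists_between ht.2
    refine ((hγ u (ht.1.trans htu.le) huT).continuousOn t ⟨ht.1, htu.le⟩).mono_of_mem_nhdsWithin ?_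
    filter_upwards [self_mem_nhdsWithin, mem_nhdsWithin_of_mem_nhds (Iio_mem_nhds htu)]
      with v hv hvu using ⟨hv.1, le_of_lt hvu⟩
  obtain ⟨z, hz⟩ := hcluster T hTpos γ hcont hlift
  have hIco : ∀ᶠ t in 𝓝[<] T, t ∈ Ico 0 T := Ico_mem_nhdsLT hTpos
  have hpz : p z = σ T := by
    have h1 : MapClusterPt (p z) (𝓝[<] T) (p ∘ γ) :=
      hz.continuousAt_comp hp.continuous.continuousAt
    have h2 : Tendsto (p ∘ γ) (𝓝[<] T) (𝓝 (σ T)) :=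
      (hσ.continuousAt.tendsto.mono_left nhdsWithin_le_nhds).congr'
        (hIco.mono fun t ht => (hlift t ht).symm)
    have : ClusterPt (p z) (𝓝 (σ T)) := ClusterPt.mono h1 h2
    exact eq_of_nhds_neBot this
  obtain ⟨e, hsource, rfl⟩ := hp z
  obtain ⟨δ, hδ, hno⟩ := key e (fun _ => rfl) (hpz ▸ e.map_source hsource)
  have hfreq := (mapClusterPt_iff_frequently.1 hz _ (e.open_source.mem_nhds hsource))
  obtain ⟨t, hmem, ht, htδ⟩ := (hfreq.and_eventually (hIco.and
    (mem_nhdsWithin_of_mem_nhds (Ioi_mem_nhds (show T - δ < T by linarith))))).exists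
  exact hno t γ ht.1 htδ ht.2.le (hγ t ht.1 ht.2) hmem

end PathLifting

theorem isLocalHomeomorph_of_deriv_ne_zero_s12 {H h : ℂ → ℂ} (hH : ∀ z, HasDerivAt H (h z) z)
    (hz : ∀ z, h z ≠ 0) : IsLocalHomeomorph H := by
  have hd : Differentiable ℂ H := fun z => (hH z).differentiableAt
  refine IsLocalHomeomorph.mk _ fun z => ?_
  have hs : HasStrictDerivAt H (h z) z := by
    simpa [(hH z).deriv] using
      (hd.contDiff (n := 1)).contDiffAt.hasStrictDerivAt (x := z) one_ne_zero
  exact ⟨(hs.hasStrictFDerivAt_equiv (hz z)).toOpenPartialHomeomorph H,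
    (hs.hasStrictFDerivAt_equiv (hz z)).mem_toOpenPartialHomeomorph_source, fun _ _ => rfl⟩

/-- A continuous local lift of a `C¹` path through a holomorphic map with nonvanishing derivative
is `C¹`. -/
theorem contDiffOn_of_comp {H h : ℂ → ℂ} (hH : ∀ z, HasDerivAt H (h z) z)
    (hz : ∀ z, h z ≠ 0) {γ σ : ℝ → ℂ} {s : Set ℝ} (hσ : ContDiffOn ℝ 1 σ s)
    (hγ : ContinuousOn γ s) (hlift : ∀ t ∈ s, H (γ t) = σ t) : ContDiffOn ℝ 1 γ s := by
  intro t ht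
  have hd : Differentiable ℂ H := fun z => (hH z).differentiableAt
  obtain ⟨e, hsource, he⟩ := isLocalHomeomorph_of_deriv_ne_zero_s12 hH hz (γ t)
  have hsymm : ContDiffAt ℂ 1 e.symm (σ t) := by
    rw [← hlift t ht, he]
    refine e.contDiffAt_symm_deriv (f₀' := h (γ t)) (hz _) (e.map_source hsource) ?_ ?_
    · rw [e.left_inv hsource, ← he]; exact hH _
    · rw [← he]; exact hd.contDiff.contDiffAt
  have hcomp : ContDiffWithinAt ℝ 1 (e.symm ∘ σ) s t :=
    hsymm.restrict_scalars ℝ |>.comp_contDiffWithinAt t (hσ t ht)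
  have heq : ∀ u ∈ s, γ u ∈ e.source → γ u = (e.symm ∘ σ) u := fun u hu hmem => by
    rw [Function.comp_apply, ← hlift u hu, he, e.left_inv hmem]
  refine hcomp.congr_of_eventuallyEq ?_ (heq t ht hsource)
  filter_upwards [self_mem_nhdsWithin,
    (hγ t ht).preimage_mem_nhdsWithin (e.open_source.mem_nhds hsource)] with u hu hmem
    using heq u hu hmem

/-- In a complete metric `|h(z)|²|dz|²`, a lift of a half-open segment through a primitive of `h`
has a cluster point at its open end. -/
theorem exists_mapClusterPt_of_conformalComplete {H h : ℂ → ℂ} (hH : ∀ z, HasDerivAt H (h z) z)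
    (hz : ∀ z, h z ≠ 0) (hcomp : ConformalComplete univ (fun z => ‖h z‖)) {w : ℂ} {γ : ℝ → ℂ}
    (hγ : ContinuousOn γ (Ico 0 1)) (hlift : ∀ t ∈ Ico (0 : ℝ) 1, H (γ t) = t * w) :
    ∃ z, MapClusterPt z (𝓝[<] 1) γ := by
  have hC1 : ContDiffOn ℝ 1 γ (Ico 0 1) :=
    contDiffOn_of_comp hH hz (σ := fun t : ℝ => t * w)
      (Complex.ofRealCLM.contDiff.mul contDiff_const).contDiffOn hγ hlift
  have hspeed : ∀ t ∈ Ico (0 : ℝ) 1, ‖h (γ t)‖ * ‖derivWithin γ (Ico 0 1) t‖ = ‖w‖ := by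
    intro t ht
    have hγ' := (hC1.differentiableOn one_ne_zero t ht).hasDerivWithinAt
    have h1 : HasDerivWithinAt (H ∘ γ) (h (γ t) * derivWithin γ (Ico 0 1) t) (Ico 0 1) t :=
      (hH (γ t)).comp_hasDerivWithinAt t hγ'
    have h2 : HasDerivWithinAt (H ∘ γ) w (Ico 0 1) t := by
      have : HasDerivAt (fun t : ℝ => (t : ℂ) * w) w t := by
        simpa using (Complex.ofRealCLM.hasDerivAt (x := t)).mul_const w
      exact this.hasDerivWithinAt.congr (fun u hu => hlift u hu) (hlift t ht)
    rw [← norm_mul, (uniqueDiffOn_Ico 0 1 t ht).eq_deriv _ h1 h2]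
  have hlen : PathLength (fun z => ‖h z‖) γ ≠ ⊤ := by
    rw [PathLength, setLIntegral_congr_fun measurableSet_Ico
      (g := fun _ => ENNReal.ofReal ‖w‖) fun t ht => by simp only [hspeed t ht]]
    simp
  have hdiv : ¬ DivergentPath γ := fun hd => hlen (hcomp γ hC1 (mapsTo_univ _ _) hd)
  simp only [DivergentPath, not_forall, not_exists, not_and, not_not] at hdiv
  obtain ⟨K, hK, hret⟩ := hdiv
  have hfreq : ∃ᶠ t in 𝓝[<] (1 : ℝ), γ t ∈ K := by
    rw [(nhdsLT_basis (1 : ℝ)).frequently_iff]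
    intro a ha
    obtain ⟨b, hab, hb⟩ := exists_between (max_lt ha zero_lt_one)
    obtain ⟨t, ht, htK⟩ := hret b ⟨(le_max_right _ _).trans hab.le, hb⟩
    exact ⟨t, ⟨((le_max_left _ _).trans_lt hab).trans_le ht.1, ht.2⟩, htK⟩
  obtain ⟨z, -, hzc⟩ := hK.exists_mapClusterPt_of_frequently hfreq
  exact ⟨z, hzc⟩

/-- The developing map of a complete flat metric on the plane has a continuous right inverse. -/
theorem exists_continuous_rightInverse {H h : ℂ → ℂ} (hH : ∀ z, HasDerivAt H (h z) z)
    (hz : ∀ z, h z ≠ 0) (hcomp : ConformalComplete univ (fun z => ‖h z‖)) (h0 : H 0 = 0) :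
    ∃ G : ℂ → ℂ, Continuous G ∧ Function.RightInverse G H ∧ G 0 = 0 := by
  have hloc := isLocalHomeomorph_of_deriv_ne_zero_s12 hH hz
  have hex : ∀ w : ℂ, ∃ γ, IsLiftUpTo H (fun t : ℝ => t * w) 0 1 γ := by
    intro w
    refine hloc.exists_isLiftUpTo (by fun_prop) (by simp [h0]) (fun T hT γ hγ hlift => ?_) 1
    have hmaps : MapsTo (fun t : ℝ => T * t) (Ico 0 1) (Ico 0 T) := fun t ht =>
      ⟨mul_nonneg hT.le ht.1, by nlinarith [ht.2]⟩
    obtain ⟨z, hzc⟩ := exists_mapClusterPt_of_conformalComplete hH hz hcomp (w := T * w)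
      (γ := γ ∘ fun t : ℝ => T * t) (hγ.comp (by fun_prop) hmaps) fun t ht => by
        rw [Function.comp_apply, hlift _ (hmaps ht)]
        push_cast
        ring
    refine ⟨z, MapClusterPt.of_comp (φ := fun t : ℝ => T * t) (p := 𝓝[<] 1) ?_ hzc⟩
    refine tendsto_nhdsWithin_iff.2 ⟨?_, ?_⟩
    · refine Tendsto.mono_left ?_ nhdsWithin_le_nhds
      simpa using (show Continuous fun t : ℝ => T * t by fun_prop).tendsto 1
    · filter_upwards [self_mem_nhdsWithin] with t ht
      have : t < 1 := ht
      show T * t < T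
      nlinarith
  choose Γ hΓ using hex
  have hcont : Continuous fun x : unitInterval × ℂ => Γ x.2 x.1 := by
    refine hloc.continuous_lift (T2Space.isSeparatedMap H)
      ⟨fun x : unitInterval × ℂ => ((x.1 : ℝ) : ℂ) * x.2, by fun_prop⟩ ?_ ?_ fun w => ?_
    · ext x
      exact (hΓ x.2).lifts x.1 x.1.2
    · simpa [(hΓ _).map_zero] using continuous_const
    · exact continuousOn_iff_continuous_domRestrict.1 (hΓ w).continuousOn
  refine ⟨fun w => Γ w 1, hcont.comp (.prodMk_right (1 : unitInterval)), fun w => ?_, ?_⟩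
  · simpa using (hΓ w).lifts 1 (by simp)
  · refine (hΓ 0).eqOn hloc zero_le_one ⟨continuousOn_const, rfl, fun t _ => ?_⟩ (by simp)
    simp [h0]

/-- An entire function of at most linear growth has constant derivative. -/
theorem deriv_eq_of_norm_le_add {f : ℂ → ℂ} (hf : Differentiable ℂ f) {M : ℝ}
    (hM : ∀ z, ‖f z‖ ≤ ‖z‖ + M) (z w : ℂ) : deriv f z = deriv f w := by
  have hM0 : 0 ≤ M := by simpa using (norm_nonneg _).trans (hM 0)
  refine Differentiable.apply_eq_apply_of_bounded (fun x => ?_)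
    (isBounded_iff_forall_norm_le.2 ⟨2 + M, ?_⟩) z w
  · exact (hf.contDiff (n := 2)).differentiable_deriv_two x
  · rintro _ ⟨c, rfl⟩
    have hR : 0 < 1 + ‖c‖ := by positivity
    have := Complex.norm_deriv_le_of_forall_mem_sphere_norm_le (C := (2 + M) * (1 + ‖c‖)) hR
      (hf.diffContOnCl (s := ball c (1 + ‖c‖))) fun z hz => by
        have h1 : ‖z‖ ≤ ‖z - c‖ + ‖c‖ := by simpa using norm_add_le (z - c) c
        rw [mem_sphere_iff_norm.1 hz] at h1
        nlinarith [hM z, norm_nonneg c]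
    rwa [mul_div_assoc, div_self hR.ne', mul_one] at this

/-- A nowhere vanishing entire function of at most linear growth is constant. -/
theorem eq_of_norm_le_add_of_ne_zero {f : ℂ → ℂ} (hf : Differentiable ℂ f) {M : ℝ}
    (hM : ∀ z, ‖f z‖ ≤ ‖z‖ + M) (hne : ∀ z, f z ≠ 0) (z w : ℂ) : f z = f w := by
  set a := deriv f 0 with ha
  have hlin : ∀ z, f z = a * z + f 0 := by
    intro z
    have hd : ∀ z, HasDerivAt (fun z => f z - a * z) 0 z := fun z => by
      have := (hf z).hasDerivAt.sub ((hasDerivAt_id z).const_mul a)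
      simpa [deriv_eq_of_norm_le_add hf hM z 0, ha] using! this
    have := is_const_of_deriv_eq_zero (fun z => (hd z).differentiableAt)
      (fun z => (hd z).deriv) z 0
    simp only [mul_zero, sub_zero] at this
    rw [← this]
    ring
  have ha0 : a = 0 := by
    by_contra h
    refine hne (-f 0 / a) ?_
    rw [hlin, mul_div_cancel₀ _ h]
    ring
  rw [hlin z, hlin w, ha0]
  ring

/-- An entire local biholomorphism fixing `0` with a continuous right inverse fixing `0` is
linear. -/
theorem eq_const_mul_of_rightInverse {H h G : ℂ → ℂ} (hH : ∀ z, HasDerivAt H (h z) z)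
    (hz : ∀ z, h z ≠ 0) (h0 : H 0 = 0) (hG : Continuous G) (hGH : Function.RightInverse G H)
    (hG0 : G 0 = 0) : ∃ a, ∀ z, H z = a * z := by
  have hd : Differentiable ℂ H := fun z => (hH z).differentiableAt
  have hloc := isLocalHomeomorph_of_deriv_ne_zero_s12 hH hz
  have hleft : G ∘ H = id :=
    (T2Space.isSeparatedMap H).eq_of_comp_eq hloc.isLocallyInjective (hG.comp hd.continuous)
      continuous_id (funext fun z => hGH (H z)) 0 (by simp [h0, hG0])
  have hleft' : ∀ z, G (H z) = z := fun z => congrFun hleft z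
  set u := dslope H 0 with hu
  have hud : Differentiable ℂ u := fun z =>
    ((Complex.differentiableOn_dslope univ_mem).2 hd.differentiableOn z
      (mem_univ z)).differentiableAt univ_mem
  have hHu : ∀ z, H z = z * u z := fun z => by
    simpa [h0] using (sub_smul_dslope H 0 z).symm
  have hune : ∀ z, u z ≠ 0 := by
    intro z hzu
    have hz0 : z = 0 := by rw [← hleft' z, hHu z, hzu, mul_zero, hG0]
    rw [hz0, hu, dslope_same, (hH 0).deriv] at hzu
    exact hz 0 hzu
  have hvd : Differentiable ℂ fun z => (u z)⁻¹ := hud.inv hune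
  obtain ⟨M, hM⟩ := ((isCompact_closedBall (0 : ℂ) 1).image hG).exists_bound_of_continuousOn
    hvd.continuous.continuousOn
  have hM0 : 0 ≤ M := (norm_nonneg _).trans (hM (G 0) ⟨0, by simp, rfl⟩)
  have hbound : ∀ z, ‖(u z)⁻¹‖ ≤ ‖z‖ + M := by
    intro z
    by_cases hz1 : ‖H z‖ ≤ 1
    · have := hM z ⟨H z, by simpa using hz1, hleft' z⟩
      linarith [norm_nonneg z]
    · rw [hHu, norm_mul] at hz1
      have hupos : 0 < ‖u z‖ := norm_pos_iff.2 (hune z)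
      have : ‖(u z)⁻¹‖ ≤ ‖z‖ := by
        rw [norm_inv, inv_le_iff_one_le_mul₀ hupos]
        linarith
      linarith
  refine ⟨u 0, fun z => ?_⟩
  rw [hHu z, inv_injective (eq_of_norm_le_add_of_ne_zero hvd hbound
    (fun z => inv_ne_zero (hune z)) z 0), mul_comm]

/-- If a nowhere-vanishing entire function `h` induces a complete flat conformal
metric `|h(z)|²|dz|²` on `ℂ`, then `h` is constant. -/
theorem complete_flat_metric_on_plane_implies_constant
    (h : ℂ → ℂ) (hh : Differentiable ℂ h) (hz : ∀ z : ℂ, h z ≠ 0)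
    (hcomp : ConformalComplete Set.univ (fun z => ‖h z‖)) :
    ∀ z w : ℂ, h z = h w := by
  obtain ⟨H₀, hH₀⟩ := hh.isExactOn_univ
  have hH : ∀ z, HasDerivAt (fun z => H₀ z - H₀ 0) (h z) z := fun z =>
    (hH₀ z (mem_univ z)).sub_const _
  obtain ⟨G, hG, hGH, hG0⟩ := exists_continuous_rightInverse hH hz hcomp (sub_self _)
  obtain ⟨a, ha⟩ := eq_const_mul_of_rightInverse hH hz (sub_self _) hG hGH hG0
  have hconst : ∀ z, h z = a := fun z => by
    have := hH z
    rw [funext ha] at this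
    exact this.unique (by simpa using (hasDerivAt_id z).const_mul a)
  intro z w
  rw [hconst z, hconst w]

end
end

section
/- Let Ω ⊆ ℂ be a nonempty open connected set, let h : Ω → ℂ be a nowhere-vanishing holomorphic function, and equip Ω with the flat conformal metric dσ² = |h(z)|²|dz|². Then for each point p ∈ Ω there exist R₀ with 0 < R₀ ≤ +∞, a holomorphic map Ψ : Δ_{R₀} = {w : |w| < R₀} → Ω with Ψ(0) = p which is a local isometry, i.e. |h(Ψ(w))|·|Ψ′(w)| = 1 for all w ∈ Δ_{R₀}, and a point a₀ with |a₀| = 1 such that the path s ↦ Ψ(a₀ s), s ∈ [0, R₀), is divergent in Ω (it eventually leaves every compact subset of Ω as s → R₀). -/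
open MeasureTheory Set
open scoped ENNReal Classical

noncomputable section

/-- The open disk `Δ_{R₀} = {w : |w| < R₀}` of (possibly infinite) radius `R₀ ∈ ℝ≥0∞`. -/
def EDisk (R₀ : ℝ≥0∞) : Set ℂ := {w : ℂ | ENNReal.ofReal ‖w‖ < R₀}

open Filter Metric Topology

/-- `f` is, at every point of `U`, an integral curve in complex time of the vector field `1 / h`
on `Ω`. -/
def IsComplexFlow (h : ℂ → ℂ) (Ω U : Set ℂ) (f : ℂ → ℂ) : Prop :=
  ∀ w ∈ U, f w ∈ Ω ∧ HasDerivAt f (h (f w))⁻¹ w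

variable {Ω U V : Set ℂ} {h f g : ℂ → ℂ}

namespace IsComplexFlow

theorem mono (hf : IsComplexFlow h Ω U f) (hVU : V ⊆ U) : IsComplexFlow h Ω V f :=
  fun w hw ↦ hf w (hVU hw)

theorem congr (hf : IsComplexFlow h Ω U f) (hU : IsOpen U) (hfg : EqOn g f U) :
    IsComplexFlow h Ω U g := fun w hw ↦ by
  rw [hfg hw]
  exact ⟨(hf w hw).1, (hf w hw).2.congr_of_eventuallyEq (hfg.eventuallyEq_of_mem (hU.mem_nhds hw))⟩

theorem comp_add_const (hf : IsComplexFlow h Ω U f) (c : ℂ) :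
    IsComplexFlow h Ω ((· + c) ⁻¹' U) (fun w ↦ f (w + c)) :=
  fun w hw ↦ ⟨(hf _ hw).1, (hf _ hw).2.comp_add_const w c⟩

theorem differentiableOn (hf : IsComplexFlow h Ω U f) : DifferentiableOn ℂ f U :=
  fun w hw ↦ (hf w hw).2.differentiableAt.differentiableWithinAt

end IsComplexFlow

/-- A nonvanishing holomorphic function is locally the derivative of a local homeomorphism. -/
theorem exists_openPartialHomeomorph_hasDerivAt (hop : IsOpen Ω) (hh : DifferentiableOn ℂ h Ω)
    (hz : ∀ z ∈ Ω, h z ≠ 0) {q : ℂ} (hq : q ∈ Ω) :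
    ∃ e : OpenPartialHomeomorph ℂ ℂ, q ∈ e.source ∧ e.source ⊆ Ω ∧
      ∀ z ∈ e.source, HasDerivAt e (h z) z := by
  obtain ⟨r, hr, hrΩ⟩ := Metric.isOpen_iff.1 hop q hq
  obtain ⟨H, hH⟩ := (hh.mono hrΩ).isExactOn_ball
  have hd : DifferentiableOn ℂ H (ball q r) :=
    fun z hz ↦ (hH z hz).differentiableAt.differentiableWithinAt
  have hs : HasStrictDerivAt H (h q) q := by
    have := (hd.analyticAt (ball_mem_nhds q hr)).hasStrictDerivAt
    rwa [(hH q (mem_ball_self hr)).deriv] at this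
  let e₀ := (hs.hasStrictFDerivAt_equiv (hz q hq)).toOpenPartialHomeomorph H
  have he₀ : q ∈ e₀.source :=
    (hs.hasStrictFDerivAt_equiv (hz q hq)).mem_toOpenPartialHomeomorph_source
  refine ⟨e₀.restrOpen (ball q r) isOpen_ball, ⟨he₀, mem_ball_self hr⟩,
    fun z hz ↦ hrΩ hz.2, fun z hz ↦ hH z hz.2⟩

/-- Local existence: near `q` there are solutions on disks of a uniform radius, each of which
reaches all points near `q`. -/
theorem exists_uniform_isComplexFlow (hop : IsOpen Ω) (hh : DifferentiableOn ℂ h Ω)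
    (hz : ∀ z ∈ Ω, h z ≠ 0) {q : ℂ} (hq : q ∈ Ω) :
    ∃ δ > 0, ∃ N ∈ 𝓝 q, ∀ q' ∈ N, ∃ f, IsComplexFlow h Ω (ball 0 δ) f ∧ f 0 = q' ∧
      N ⊆ f '' ball 0 δ := by
  obtain ⟨e, hqe, heΩ, hde⟩ := exists_openPartialHomeomorph_hasDerivAt hop hh hz hq
  obtain ⟨r, hr, hrt⟩ := Metric.isOpen_iff.1 e.open_target (e q) (e.map_source hqe)
  refine ⟨2 * (r / 3), by positivity, e.source ∩ e ⁻¹' ball (e q) (r / 3),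
    inter_mem (e.open_source.mem_nhds hqe)
      ((e.continuousAt hqe).preimage_mem_nhds (ball_mem_nhds _ (by positivity))), ?_⟩
  rintro q' ⟨hq's, hq'b⟩
  rw [mem_preimage, mem_ball_iff_norm] at hq'b
  refine ⟨fun w ↦ e.symm (w + e q'), ?_, by simp [e.left_inv hq's], ?_⟩
  · have hflow : IsComplexFlow h Ω e.target e.symm := fun w hw ↦
      ⟨heΩ (e.map_target hw), e.hasDerivAt_symm hw (hz _ (heΩ (e.map_target hw)))
        (hde _ (e.map_target hw))⟩
    refine (hflow.comp_add_const (e q')).mono fun w hw ↦ hrt ?_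
    rw [mem_ball_zero_iff] at hw
    rw [mem_ball_iff_norm, add_sub_assoc]
    linarith [norm_add_le w (e q' - e q)]
  · rintro q'' ⟨hq''s, hq''b⟩
    rw [mem_preimage, mem_ball_iff_norm] at hq''b
    refine ⟨e q'' - e q', ?_, by simp [e.left_inv hq''s]⟩
    rw [mem_ball_zero_iff]
    have := norm_sub_le (e q'' - e q) (e q' - e q)
    rw [sub_sub_sub_cancel_right] at this
    linarith

namespace IsComplexFlow

theorem eventuallyEq (hop : IsOpen Ω) (hh : DifferentiableOn ℂ h Ω) (hz : ∀ z ∈ Ω, h z ≠ 0)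
    (hU : IsOpen U) (hf : IsComplexFlow h Ω U f) (hg : IsComplexFlow h Ω U g) {w₀ : ℂ}
    (hw₀ : w₀ ∈ U) (hfg : f w₀ = g w₀) : f =ᶠ[𝓝 w₀] g := by
  obtain ⟨e, hqe, heΩ, hde⟩ := exists_openPartialHomeomorph_hasDerivAt hop hh hz (hf w₀ hw₀).1
  have hfn := (hf w₀ hw₀).2.continuousAt.preimage_mem_nhds (e.open_source.mem_nhds hqe)
  have hgn := (hg w₀ hw₀).2.continuousAt.preimage_mem_nhds
    (e.open_source.mem_nhds (hfg ▸ hqe))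
  obtain ⟨r, hr, hrs⟩ := Metric.mem_nhds_iff.1 (inter_mem (hU.mem_nhds hw₀) (inter_mem hfn hgn))
  have hderiv : ∀ k : ℂ → ℂ, IsComplexFlow h Ω U k → ∀ w ∈ U, k w ∈ e.source →
      HasDerivAt (e ∘ k) 1 w := fun k hk w hw hkw ↦ by
    simpa [mul_inv_cancel₀ (hz _ (hk w hw).1)] using (hde _ hkw).comp w (hk w hw).2
  have hf' : ∀ w ∈ ball w₀ r, HasDerivAt (e ∘ f) 1 w :=
    fun w hw ↦ hderiv f hf w (hrs hw).1 (hrs hw).2.1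
  have hg' : ∀ w ∈ ball w₀ r, HasDerivAt (e ∘ g) 1 w :=
    fun w hw ↦ hderiv g hg w (hrs hw).1 (hrs hw).2.2
  have heq : EqOn (e ∘ f) (e ∘ g) (ball w₀ r) :=
    isOpen_ball.eqOn_of_deriv_eq (convex_ball w₀ r).isPreconnected
      (fun w hw ↦ (hf' w hw).differentiableAt.differentiableWithinAt)
      (fun w hw ↦ (hg' w hw).differentiableAt.differentiableWithinAt)
      (fun w hw ↦ (hf' w hw).deriv.trans (hg' w hw).deriv.symm) (mem_ball_self hr)
      (congrArg e hfg)
  filter_upwards [ball_mem_nhds w₀ hr] with w hw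
  exact e.injOn (hrs hw).2.1 (hrs hw).2.2 (heq hw)

/-- Two solutions on a connected open set that agree at one point are equal. -/
theorem eqOn (hop : IsOpen Ω) (hh : DifferentiableOn ℂ h Ω) (hz : ∀ z ∈ Ω, h z ≠ 0)
    (hU : IsOpen U) (hUc : IsPreconnected U) (hf : IsComplexFlow h Ω U f)
    (hg : IsComplexFlow h Ω U g) {w₀ : ℂ} (hw₀ : w₀ ∈ U) (hfg : f w₀ = g w₀) : EqOn f g U :=
  (hf.differentiableOn.analyticOnNhd hU).eqOn_of_preconnected_of_eventuallyEq
    (hg.differentiableOn.analyticOnNhd hU) hUc hw₀ (hf.eventuallyEq hop hh hz hU hg hw₀ hfg)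

end IsComplexFlow

theorem EDisk_top : EDisk ⊤ = univ := by
  ext w; simp [EDisk]

theorem EDisk_of_ne_top {R : ℝ≥0∞} (hR : R ≠ ⊤) : EDisk R = ball 0 R.toReal := by
  ext w
  rw [mem_ball_zero_iff, ← ENNReal.ofReal_lt_iff_lt_toReal (norm_nonneg w) hR]
  rfl

theorem EDisk_ofReal {R : ℝ} (hR : 0 ≤ R) : EDisk (ENNReal.ofReal R) = ball 0 R := by
  rw [EDisk_of_ne_top ENNReal.ofReal_ne_top, ENNReal.toReal_ofReal hR]

theorem isOpen_EDisk (R : ℝ≥0∞) : IsOpen (EDisk R) := by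
  by_cases hR : R = ⊤
  · rw [hR, EDisk_top]; exact isOpen_univ
  · rw [EDisk_of_ne_top hR]; exact isOpen_ball

theorem convex_EDisk (R : ℝ≥0∞) : Convex ℝ (EDisk R) := by
  by_cases hR : R = ⊤
  · rw [hR, EDisk_top]; exact convex_univ
  · rw [EDisk_of_ne_top hR]; exact convex_ball _ _

theorem zero_mem_EDisk {R : ℝ≥0∞} : (0 : ℂ) ∈ EDisk R ↔ 0 < R := by
  simp [EDisk]

/-- Locally consistent solutions glue along the diagonal. -/
theorem IsComplexFlow.glue {F : ℂ → ℂ → ℂ} {D : ℂ → Set ℂ}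
    (hF : ∀ z ∈ U, IsComplexFlow h Ω (D z) (F z)) (hD : ∀ z ∈ U, z ∈ D z)
    (hFF : ∀ z₀ ∈ U, ∀ᶠ z in 𝓝 z₀, F z z = F z₀ z) :
    IsComplexFlow h Ω U (fun z ↦ F z z) := fun z hzU ↦
  ⟨(hF z hzU z (hD z hzU)).1,
    (hF z hzU z (hD z hzU)).2.congr_of_eventuallyEq (hFF z hzU)⟩

/-- There is a solution on a disk of maximal radius with given initial value. -/
theorem exists_maximal_isComplexFlow (hop : IsOpen Ω) (hh : DifferentiableOn ℂ h Ω)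
    (hz : ∀ z ∈ Ω, h z ≠ 0) {p : ℂ} (hp : p ∈ Ω) :
    ∃ R₀ > 0, (∃ Ψ, IsComplexFlow h Ω (EDisk R₀) Ψ ∧ Ψ 0 = p) ∧
      ∀ R f, IsComplexFlow h Ω (EDisk R) f → f 0 = p → R ≤ R₀ := by
  set S : Set ℝ≥0∞ := {R | ∃ f, IsComplexFlow h Ω (EDisk R) f ∧ f 0 = p}
  have hpos : 0 < sSup S := by
    obtain ⟨δ, hδ, N, hN, hflow⟩ := exists_uniform_isComplexFlow hop hh hz hp
    obtain ⟨f, hf, hf0, -⟩ := hflow p (mem_of_mem_nhds hN)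
    exact lt_sSup_iff.2 ⟨ENNReal.ofReal δ, ⟨f, by rwa [EDisk_ofReal hδ.le], hf0⟩, by simpa⟩
  have hex : ∀ w ∈ EDisk (sSup S), ∃ R f, w ∈ EDisk R ∧ IsComplexFlow h Ω (EDisk R) f ∧
      f 0 = p := fun w hw ↦ by
    obtain ⟨R, ⟨f, hf, hf0⟩, hR⟩ := lt_sSup_iff.1 (mem_ofPred.1 hw)
    exact ⟨R, f, hR, hf, hf0⟩
  choose! ρ F hwρ hF hF0 using hex
  refine ⟨sSup S, hpos, ⟨fun w ↦ F w w, IsComplexFlow.glue hF hwρ fun w₀ hw₀ ↦ ?_,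
    hF0 0 (zero_mem_EDisk.2 hpos)⟩, fun R f hf hf0 ↦ le_sSup ⟨f, hf, hf0⟩⟩
  filter_upwards [(isOpen_EDisk _).mem_nhds hw₀, (isOpen_EDisk _).mem_nhds (hwρ w₀ hw₀)]
    with w hw hww₀
  refine ((hF w hw).mono inter_subset_left).eqOn hop hh hz
    ((isOpen_EDisk (ρ w)).inter (isOpen_EDisk (ρ w₀)))
    ((convex_EDisk _).inter (convex_EDisk _)).isPreconnected
    ((hF w₀ hw₀).mono inter_subset_right) (w₀ := 0) ⟨?_, ?_⟩
    ((hF0 w hw).trans (hF0 w₀ hw₀).symm) ⟨hwρ w hw, hww₀⟩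
  · exact zero_mem_EDisk.2 (zero_le.trans_lt (hwρ w hw))
  · exact zero_mem_EDisk.2 (zero_le.trans_lt (hwρ w₀ hw₀))

/-- A solution on a disk that continues to disks of a uniform radius around all points extends to
a larger disk. -/
theorem IsComplexFlow.exists_extension (hop : IsOpen Ω) (hh : DifferentiableOn ℂ h Ω)
    (hz : ∀ z ∈ Ω, h z ≠ 0) {R δ : ℝ} (hR : 0 < R) (hδ : 0 < δ) {Ψ : ℂ → ℂ}
    (hΨ : IsComplexFlow h Ω (ball 0 R) Ψ)
    (hext : ∀ w ∈ ball 0 R, ∃ f, IsComplexFlow h Ω (ball w δ) f ∧ f w = Ψ w) :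
    ∃ f, IsComplexFlow h Ω (ball 0 (R + δ)) f ∧ f 0 = Ψ 0 := by
  choose! G hG hGw using hext
  set c : ℝ := R / (R + δ) with hc
  have hc0 : 0 < c := by positivity
  have hc1 : c * (R + δ) = R := by rw [hc]; field_simp
  have hin : ∀ z ∈ ball (0 : ℂ) (R + δ), (c * z : ℂ) ∈ ball (0 : ℂ) R := fun z hz ↦ by
    rw [mem_ball_zero_iff] at hz ⊢
    rw [norm_mul, Complex.norm_of_nonneg hc0.le]
    calc c * ‖z‖ < c * (R + δ) := by gcongr
      _ = R := hc1
  have hnear : ∀ z ∈ ball (0 : ℂ) (R + δ), z ∈ ball (c * z : ℂ) δ := fun z hz ↦ by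
    rw [mem_ball_zero_iff] at hz
    have h1c : 0 < 1 - c := by
      rw [hc, sub_pos, div_lt_one (by positivity)]; linarith
    have : z - c * z = ((1 - c : ℝ) : ℂ) * z := by push_cast; ring
    rw [mem_ball_iff_norm, this, norm_mul, Complex.norm_of_nonneg h1c.le]
    calc (1 - c) * ‖z‖ < (1 - c) * (R + δ) := by gcongr
      _ = δ := by rw [sub_mul, hc1]; ring
  refine ⟨fun z ↦ G (c * z) z, IsComplexFlow.glue (D := fun z ↦ ball (c * z) δ)
    (fun z hz ↦ hG _ (hin z hz)) hnear fun z₀ hz₀ ↦ ?_,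
    by simpa using hGw 0 (mem_ball_self hR)⟩
  have hcont : ContinuousAt (fun z : ℂ ↦ (c * z : ℂ)) z₀ := by fun_prop
  filter_upwards [isOpen_ball.mem_nhds hz₀, isOpen_ball.mem_nhds (hnear z₀ hz₀),
    hcont.preimage_mem_nhds (ball_mem_nhds _ hδ)] with z hzb hzz₀ hcz
  have hagree : G (c * z₀) (c * z) = Ψ (c * z) :=
    ((hG _ (hin z₀ hz₀)).mono inter_subset_left).eqOn hop hh hz
      (isOpen_ball.inter isOpen_ball)
      ((convex_ball _ _).inter (convex_ball _ _)).isPreconnected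
      (hΨ.mono inter_subset_right) ⟨mem_ball_self hδ, hin z₀ hz₀⟩ (hGw _ (hin z₀ hz₀))
      ⟨hcz, hin z hzb⟩
  exact ((hG _ (hin z hzb)).mono inter_subset_left).eqOn hop hh hz
    (isOpen_ball.inter isOpen_ball)
    ((convex_ball _ _).inter (convex_ball _ _)).isPreconnected
    ((hG _ (hin z₀ hz₀)).mono inter_subset_right) ⟨mem_ball_self hδ, hcz⟩
    ((hGw _ (hin z hzb)).trans hagree.symm) ⟨hnear z hzb, hzz₀⟩

/-- Solutions starting in a compact set exist on disks of a uniform radius. -/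
theorem exists_isComplexFlow_of_isCompact (hop : IsOpen Ω) (hh : DifferentiableOn ℂ h Ω)
    (hz : ∀ z ∈ Ω, h z ≠ 0) {K : Set ℂ} (hK : IsCompact K) (hKΩ : K ⊆ Ω) :
    ∃ δ > 0, ∀ q ∈ K, ∃ f, IsComplexFlow h Ω (ball 0 δ) f ∧ f 0 = q := by
  refine hK.induction_on (p := fun S ↦ ∃ δ > 0, ∀ q ∈ S, ∃ f,
    IsComplexFlow h Ω (ball 0 δ) f ∧ f 0 = q) ⟨1, one_pos, by simp⟩
    (fun s t hst ⟨δ, hδ, H⟩ ↦ ⟨δ, hδ, fun q hq ↦ H q (hst hq)⟩) ?_ fun q hq ↦ ?_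
  · rintro s t ⟨δ, hδ, H⟩ ⟨δ', hδ', H'⟩
    refine ⟨min δ δ', lt_min hδ hδ', ?_⟩
    rintro q (hq | hq)
    · obtain ⟨f, hf, hf0⟩ := H q hq
      exact ⟨f, hf.mono (ball_subset_ball (min_le_left _ _)), hf0⟩
    · obtain ⟨f, hf, hf0⟩ := H' q hq
      exact ⟨f, hf.mono (ball_subset_ball (min_le_right _ _)), hf0⟩
  · obtain ⟨δ, hδ, N, hN, hflow⟩ := exists_uniform_isComplexFlow hop hh hz (hKΩ hq)
    refine ⟨N, mem_nhdsWithin_of_mem_nhds hN, δ, hδ, fun q' hq' ↦ ?_⟩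
    obtain ⟨f, hf, hf0, -⟩ := hflow q' hq'
    exact ⟨f, hf, hf0⟩

/-- If every radius returns to a compact subset of `Ω` arbitrarily close to the boundary circle,
the solution extends to a larger disk. -/
theorem IsComplexFlow.exists_extension_of_recurrent (hop : IsOpen Ω)
    (hh : DifferentiableOn ℂ h Ω) (hz : ∀ z ∈ Ω, h z ≠ 0) {R : ℝ} (hR : 0 < R) {Ψ : ℂ → ℂ}
    (hΨ : IsComplexFlow h Ω (ball 0 R) Ψ)
    (hrec : ∀ a : ℂ, ‖a‖ = 1 → ∃ K ⊆ Ω, IsCompact K ∧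
      ∀ s₀, 0 ≤ s₀ → s₀ < R → ∃ s, s₀ ≤ s ∧ s < R ∧ Ψ (a * s) ∈ K) :
    ∃ δ > 0, ∃ f, IsComplexFlow h Ω (ball 0 (R + δ)) f ∧ f 0 = Ψ 0 := by
  suffices H : ∃ δ > 0, ∀ w ∈ closedBall 0 R, w ∈ ball 0 R →
      ∃ f, IsComplexFlow h Ω (ball w δ) f ∧ f w = Ψ w by
    obtain ⟨δ, hδ, H⟩ := H
    exact ⟨δ, hδ, hΨ.exists_extension hop hh hz hR hδ
      fun w hw ↦ H w (ball_subset_closedBall hw) hw⟩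
  refine (isCompact_closedBall (0 : ℂ) R).induction_on (p := fun S ↦ ∃ δ > 0, ∀ w ∈ S,
    w ∈ ball 0 R → ∃ f, IsComplexFlow h Ω (ball w δ) f ∧ f w = Ψ w) ⟨1, one_pos, by simp⟩
    (fun s t hst ⟨δ, hδ, H⟩ ↦ ⟨δ, hδ, fun q hq ↦ H q (hst hq)⟩) ?_ fun w₀ hw₀ ↦ ?_
  · rintro s t ⟨δ, hδ, H⟩ ⟨δ', hδ', H'⟩
    refine ⟨min δ δ', lt_min hδ hδ', ?_⟩
    rintro w (hw | hw) hwR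
    · obtain ⟨f, hf, hf0⟩ := H w hw hwR
      exact ⟨f, hf.mono (ball_subset_ball (min_le_left _ _)), hf0⟩
    · obtain ⟨f, hf, hf0⟩ := H' w hw hwR
      exact ⟨f, hf.mono (ball_subset_ball (min_le_right _ _)), hf0⟩
  -- It suffices to continue `Ψ` to one disk around `w₀`.
  suffices H : ∃ ε > 0, ∃ f, IsComplexFlow h Ω (ball w₀ ε) f ∧
      ∀ w ∈ ball w₀ ε, w ∈ ball 0 R → f w = Ψ w by
    obtain ⟨ε, hε, f, hf, hfΨ⟩ := H
    refine ⟨ball w₀ (ε / 2), mem_nhdsWithin_of_mem_nhds (ball_mem_nhds _ (by positivity)),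
      ε / 2, by positivity, fun w hw hwR ↦ ⟨f, hf.mono (ball_subset_ball' ?_),
        hfΨ w (ball_subset_ball (by linarith) hw) hwR⟩⟩
    rw [mem_ball] at hw
    linarith
  rcases (mem_closedBall_zero_iff.1 hw₀).lt_or_eq with hlt | heq
  · refine ⟨R - ‖w₀‖, by linarith, Ψ, hΨ.mono (ball_subset_ball' ?_), fun _ _ _ ↦ rfl⟩
    rw [dist_zero_right]; linarith
  obtain ⟨K, hKΩ, hK, hret⟩ := hrec (w₀ / R) (by
    rw [norm_div, heq, Complex.norm_of_nonneg hR.le, div_self hR.ne'])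
  obtain ⟨δ, hδ, hflow⟩ := exists_isComplexFlow_of_isCompact hop hh hz hK hKΩ
  obtain ⟨s, hs, hsR, hsK⟩ := hret (max 0 (R - δ / 2)) (le_max_left _ _)
    (max_lt hR (by linarith))
  obtain ⟨f, hf, hf0⟩ := hflow _ hsK
  set b : ℂ := w₀ / R * s with hb
  have hs0 : 0 ≤ s := (le_max_left _ _).trans hs
  have hsδ : R - δ / 2 ≤ s := (le_max_right _ _).trans hs
  have hbR : b ∈ ball (0 : ℂ) R := by
    rw [mem_ball_zero_iff, hb, norm_mul, norm_div, heq, Complex.norm_of_nonneg hR.le,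
      div_self hR.ne', Complex.norm_of_nonneg hs0, one_mul]
    exact hsR
  have hbw : dist w₀ b ≤ δ / 2 := by
    have hRC : (R : ℂ) ≠ 0 := by exact_mod_cast hR.ne'
    have : w₀ - b = w₀ / R * ((R - s : ℝ) : ℂ) := by rw [hb]; push_cast; field_simp
    rw [dist_eq_norm, this, norm_mul, norm_div, heq, Complex.norm_of_nonneg hR.le,
      div_self hR.ne', Complex.norm_of_nonneg (by linarith)]
    linarith
  have hfb : IsComplexFlow h Ω (ball b δ) (fun w ↦ f (w + -b)) :=
    (hf.comp_add_const (-b)).mono fun w hw ↦ by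
      rw [mem_ball_iff_norm] at hw
      simpa [← sub_eq_add_neg] using hw
  have hsub : ball w₀ (δ / 2) ⊆ ball b δ := ball_subset_ball' (by linarith)
  refine ⟨δ / 2, by positivity, _, hfb.mono hsub, fun w hw hwR ↦ ?_⟩
  exact (hfb.mono inter_subset_left).eqOn hop hh hz (isOpen_ball.inter isOpen_ball)
    ((convex_ball _ _).inter (convex_ball _ _)).isPreconnected
    (hΨ.mono inter_subset_right) (w₀ := b) ⟨mem_ball_self hδ, hbR⟩ (by simpa using hf0)
    ⟨hsub hw, hwR⟩

/-- The periods of an entire solution lie on a real line. -/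
theorem IsComplexFlow.exists_orthogonal_periods (hz : ∀ z ∈ Ω, h z ≠ 0) {Ψ : ℂ → ℂ}
    (hΨ : IsComplexFlow h Ω univ Ψ) :
    ∃ a : ℂ, ‖a‖ = 1 ∧ ∀ T, Function.Periodic Ψ T → (T * star a).re = 0 := by
  by_cases htriv : ∀ T, Function.Periodic Ψ T → T = 0
  · exact ⟨1, by simp, fun T hT ↦ by simp [htriv T hT]⟩
  push Not at htriv
  obtain ⟨τ, hτ, hτ0⟩ := htriv
  have hτn : ‖τ‖ ≠ 0 := norm_ne_zero_iff.2 hτ0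
  refine ⟨Complex.I * τ / ‖τ‖, by simp [hτn], fun T hT ↦ ?_⟩
  by_contra hne
  have hdet : T.im * τ.re - T.re * τ.im ≠ 0 := by
    refine fun h0 ↦ hne ?_
    have : T * star (Complex.I * τ / ‖τ‖) = T * (-Complex.I * star τ) * ((‖τ‖⁻¹ : ℝ) : ℂ) := by
      simp [div_eq_mul_inv]; ring
    rw [this, Complex.re_mul_ofReal]
    simp
    left
    linarith
  -- Reducing modulo the two independent periods shows that `Ψ` is bounded.
  have hbdd : Bornology.IsBounded (range Ψ) := by
    have hcont : Continuous Ψ := continuous_iff_continuousAt.2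
      fun w ↦ (hΨ w (mem_univ w)).2.continuousAt
    refine ((isCompact_closedBall (0 : ℂ) (‖τ‖ + ‖T‖)).image hcont).isBounded.subset ?_
    rintro _ ⟨w, rfl⟩
    set x : ℝ := (w.re * T.im - w.im * T.re) / (T.im * τ.re - T.re * τ.im) with hx
    set y : ℝ := (w.im * τ.re - w.re * τ.im) / (T.im * τ.re - T.re * τ.im) with hy
    have hw : w = x * τ + y * T := by
      have hre : w.re = x * τ.re + y * T.re := by rw [hx, hy]; field_simp; ring
      have him : w.im = x * τ.im + y * T.im := by rw [hx, hy]; field_simp; ring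
      apply Complex.ext <;> simpa
    refine ⟨(Int.fract x : ℝ) * τ + (Int.fract y : ℝ) * T, ?_, ?_⟩
    · rw [mem_closedBall_zero_iff]
      refine (norm_add_le _ _).trans ?_
      rw [norm_mul, norm_mul, Complex.norm_of_nonneg (Int.fract_nonneg x),
        Complex.norm_of_nonneg (Int.fract_nonneg y)]
      exact add_le_add (mul_le_of_le_one_left (norm_nonneg _) (Int.fract_lt_one x).le)
        (mul_le_of_le_one_left (norm_nonneg _) (Int.fract_lt_one y).le)
    · have hper : Function.Periodic Ψ (⌊x⌋ * τ + ⌊y⌋ * T) :=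
        (hτ.int_mul _).add_period (hT.int_mul _)
      rw [← hper]
      congr 1
      conv_rhs => rw [hw, ← Int.floor_add_fract x, ← Int.floor_add_fract y]
      push_cast
      ring
  have hdiff : Differentiable ℂ Ψ := fun w ↦ (hΨ w (mem_univ w)).2.differentiableAt
  have hconst : Ψ = fun _ ↦ Ψ 0 := funext fun w ↦ hdiff.apply_eq_apply_of_bounded hbdd w 0
  have hd := (hΨ 0 (mem_univ 0))
  have h0 : HasDerivAt Ψ 0 0 := by rw [hconst]; exact hasDerivAt_const _ _
  exact inv_ne_zero (hz _ hd.1) (hd.2.unique h0)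

/-- An entire solution has a radius that leaves every compact subset of `Ω`. -/
theorem IsComplexFlow.exists_bddAbove_of_univ (hop : IsOpen Ω) (hh : DifferentiableOn ℂ h Ω)
    (hz : ∀ z ∈ Ω, h z ≠ 0) {Ψ : ℂ → ℂ} (hΨ : IsComplexFlow h Ω univ Ψ) :
    ∃ a : ℂ, ‖a‖ = 1 ∧ ∀ K ⊆ Ω, IsCompact K → BddAbove {s : ℝ | Ψ (a * s) ∈ K} := by
  obtain ⟨a, ha, hper⟩ := hΨ.exists_orthogonal_periods hz
  refine ⟨a, ha, fun K hKΩ hK ↦ hK.induction_on (p := fun S ↦ BddAbove {s : ℝ | Ψ (a * s) ∈ S})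
    (by simp) (fun s t hst hb ↦ hb.mono fun x hx ↦ hst hx) (fun s t hs ht ↦ hs.union ht)
    fun q hq ↦ ?_⟩
  obtain ⟨δ, hδ, N, hN, hflow⟩ := exists_uniform_isComplexFlow hop hh hz (hKΩ hq)
  refine ⟨N, mem_nhdsWithin_of_mem_nhds hN, ?_⟩
  rcases {s : ℝ | Ψ (a * s) ∈ N}.eq_empty_or_nonempty with hemp | ⟨t, ht⟩
  · rw [hemp]; exact bddAbove_empty
  refine ⟨t + δ, fun s hs ↦ ?_⟩
  obtain ⟨f, hf, hf0, hfN⟩ := hflow _ ht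
  obtain ⟨u, hu, hfu⟩ := hfN hs
  have hshift : ∀ c, IsComplexFlow h Ω univ (fun w ↦ Ψ (w + c)) :=
    fun c ↦ (hΨ.comp_add_const c).mono (by simp)
  have hu' : f u = Ψ (u + a * t) := hf.eqOn hop hh hz isOpen_ball
    (convex_ball _ _).isPreconnected ((hshift (a * t)).mono (subset_univ _))
    (mem_ball_self hδ) (by simpa using hf0) hu
  have hT : Function.Periodic Ψ (u + a * t - a * s) := fun w ↦
    (hshift _).eqOn hop hh hz isOpen_univ isPreconnected_univ hΨ (mem_univ (a * s))
      (by rw [← hfu, hu']; congr 1; ring) (mem_univ w)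
  have hre := hper _ hT
  have haa : a * star a = 1 := by
    rw [Complex.star_def, Complex.mul_conj, Complex.normSq_eq_norm_sq, ha]; simp
  have hsum : (u + a * t - a * s) * star a = u * star a + ((t - s : ℝ) : ℂ) := by
    push_cast
    linear_combination ((t : ℂ) - s) * haa
  rw [hsum, Complex.add_re, Complex.ofReal_re] at hre
  have hule : (u * star a).re ≤ ‖u‖ := by
    simpa [ha] using Complex.re_le_norm (u * star a)
  have := mem_ball_zero_iff.1 hu
  linarith

/-- **Fujimoto's flat-metric lemma (Lemma 3.2), planar-domain case**: for a flat
conformal metric `dσ² = |h(z)|²|dz|²` on a nonempty open connected set `Ω ⊆ ℂ`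
(`h` holomorphic and nowhere vanishing on `Ω`) and a point `p ∈ Ω`, there exist
`0 < R₀ ≤ +∞`, a holomorphic local isometry `Ψ : Δ_{R₀} → Ω` with `Ψ(0) = p`
(i.e. `|h(Ψ(w))|·|Ψ′(w)| = 1`), and a direction `a₀` with `|a₀| = 1` such that the
`Ψ`-image of the radius `s ↦ Ψ(a₀s)`, `0 ≤ s < R₀`, is divergent in `Ω`. -/
theorem exists_local_isometry_with_divergent_radius
    (Ω : Set ℂ) (hne : Ω.Nonempty) (hop : IsOpen Ω) (hconn : IsConnected Ω)
    (h : ℂ → ℂ) (hh : DifferentiableOn ℂ h Ω) (hz : ∀ z ∈ Ω, h z ≠ 0) :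
    ∀ p ∈ Ω, ∃ (R₀ : ℝ≥0∞) (Ψ : ℂ → ℂ) (a₀ : ℂ),
      0 < R₀ ∧ ‖a₀‖ = 1 ∧ Ψ 0 = p ∧
      DifferentiableOn ℂ Ψ (EDisk R₀) ∧
      MapsTo Ψ (EDisk R₀) Ω ∧
      (∀ w ∈ EDisk R₀, ‖h (Ψ w)‖ * ‖deriv Ψ w‖ = 1) ∧
      (∀ K : Set ℂ, IsCompact K → K ⊆ Ω →
        ∃ s₀ : ℝ, 0 ≤ s₀ ∧ ENNReal.ofReal s₀ < R₀ ∧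
          ∀ s : ℝ, s₀ ≤ s → ENNReal.ofReal s < R₀ → Ψ (a₀ * s) ∉ K) := by
  intro p hp
  obtain ⟨R₀, hR₀, ⟨Ψ, hΨ, hΨ0⟩, hmax⟩ := exists_maximal_isComplexFlow hop hh hz hp
  suffices H : ∃ a₀ : ℂ, ‖a₀‖ = 1 ∧ ∀ K : Set ℂ, IsCompact K → K ⊆ Ω →
      ∃ s₀ : ℝ, 0 ≤ s₀ ∧ ENNReal.ofReal s₀ < R₀ ∧
        ∀ s : ℝ, s₀ ≤ s → ENNReal.ofReal s < R₀ → Ψ (a₀ * s) ∉ K by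
    obtain ⟨a₀, ha₀, hdiv⟩ := H
    refine ⟨R₀, Ψ, a₀, hR₀, ha₀, hΨ0, hΨ.differentiableOn, fun w hw ↦ (hΨ w hw).1,
      fun w hw ↦ ?_, hdiv⟩
    rw [(hΨ w hw).2.deriv, norm_inv,
      mul_inv_cancel₀ (norm_ne_zero_iff.2 (hz _ (hΨ w hw).1))]
  by_cases htop : R₀ = ⊤
  · subst htop
    rw [EDisk_top] at hΨ
    obtain ⟨a, ha, hbdd⟩ := hΨ.exists_bddAbove_of_univ hop hh hz
    refine ⟨a, ha, fun K hK hKΩ ↦ ?_⟩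
    obtain ⟨B, hB⟩ := hbdd K hKΩ hK
    refine ⟨max 0 (B + 1), le_max_left _ _, ENNReal.ofReal_lt_top, fun s hs _ hsK ↦ ?_⟩
    have := hB hsK
    linarith [le_max_right 0 (B + 1)]
  · have hR : 0 < R₀.toReal := ENNReal.toReal_pos hR₀.ne' htop
    rw [EDisk_of_ne_top htop] at hΨ
    by_contra! hcon
    obtain ⟨δ, hδ, f, hf, hf0⟩ := hΨ.exists_extension_of_recurrent hop hh hz hR fun a ha ↦ by
      obtain ⟨K, hK, hKΩ, hret⟩ := hcon a ha
      refine ⟨K, hKΩ, hK, fun s₀ hs₀ hs₀R ↦ ?_⟩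
      obtain ⟨s, hs, hsR, hsK⟩ := hret s₀ hs₀ ((ENNReal.ofReal_lt_iff_lt_toReal hs₀ htop).2 hs₀R)
      exact ⟨s, hs, (ENNReal.ofReal_lt_iff_lt_toReal (hs₀.trans hs) htop).1 hsR, hsK⟩
    rw [← EDisk_ofReal (by positivity)] at hf
    have hle := hmax _ f hf (hf0.trans hΨ0)
    rw [ENNReal.ofReal_le_iff_le_toReal htop] at hle
    linarith

end
end
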